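/- Let R = K[x_1,...,x_n] and A = R/I a lattice ring of codimension two and dimension d, where I is a lattice ideal minimally generated by 4 binomials. Then D^{d-1}(A) is (presented as) a complete intersection quotient; in particular the canonical module K_A is Cohen–Macaulay of dimension d, the S_2-fication of A is a Macaulayfication, and the non-Cohen–Macaulay locus of A is the support of a Cohen–Macaulay module of dimension d−2. -/

import Mathlib

open CategoryTheory

noncomputable section

/-- The dimension of a module: Krull dimension of its support. -/
def moduleDim (R : Type) [CommRing R] (M : Type) [AddCommGroup M] [Module R M] :
    WithBot (WithTop ℕ) :=
  Order.krullDim (Module.support R M)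

/-- The depth of a module over a local ring: supremum of lengths of regular
sequences on `M` contained in the maximal ideal. -/
def moduleDepth (R : Type) [CommRing R] [IsLocalRing R] (M : Type) [AddCommGroup M]
    [Module R M] : ℕ∞ :=
  sSup {n : ℕ∞ | ∃ rs : List R, (rs.length : ℕ∞) = n ∧
    (∀ r ∈ rs, r ∈ IsLocalRing.maximalIdeal R) ∧ RingTheory.Sequence.IsRegular M rs}

/-- A module over a local ring is Cohen–Macaulay if it is zero or its depth
equals its (Krull) dimension. -/
def IsCM (R : Type) [CommRing R] [IsLocalRing R] (M : Type) [AddCommGroup M]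
    [Module R M] : Prop :=
  Subsingleton M ∨ moduleDim R M = (moduleDepth R M : WithBot ℕ∞)

/-- `extModule R n M N` is `Ext_R^n(M, N)` as an `R`-module object. -/
def extModule (R : Type) [CommRing R] (n : ℕ) (M N : Type) [AddCommGroup M] [Module R M]
    [AddCommGroup N] [Module R N] : ModuleCat R :=
  ((Ext R (ModuleCat R) n).obj (Opposite.op (ModuleCat.of R M))).obj (ModuleCat.of R N)

/-- A Noetherian local ring `R` of dimension `n` is Gorenstein if
`Ext^i(k, R)` vanishes for `i ≠ n` and is isomorphic to the residue field `k` for `i = n`. -/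
def IsGorensteinLocalRing (R : Type) [CommRing R] [IsLocalRing R] : Prop :=
  IsNoetherianRing R ∧
  ∀ n : ℕ, ringKrullDim R = n →
    (∀ i : ℕ, i ≠ n → Subsingleton ↥(extModule R i (IsLocalRing.ResidueField R) R)) ∧
    Nonempty (extModule R n (IsLocalRing.ResidueField R) R ≅
      ModuleCat.of R (IsLocalRing.ResidueField R))

/-- Serre's condition `S_k` (here `k = 2`): `depth M_P ≥ min(2, dim M_P)` for all primes. -/
def SerreS2 (R : Type) [CommRing R] (M : Type) [AddCommGroup M] [Module R M] : Prop :=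
  ∀ (P : Ideal R) [P.IsPrime],
    min 2 (moduleDim (Localization.AtPrime P) (LocalizedModule P.primeCompl M)) ≤
      ((moduleDepth (Localization.AtPrime P) (LocalizedModule P.primeCompl M) : ℕ∞) :
        WithBot ℕ∞)

/-- A module is unmixed if all its associated primes have the same dimension, `dim M`. -/
def IsUnmixed (A : Type) [CommRing A] (M : Type) [AddCommGroup M] [Module A M] : Prop :=
  ∀ P ∈ associatedPrimes A M, ringKrullDim (A ⧸ P) = moduleDim A M

open MvPolynomial

/-- The binomial `x^{u₊} - x^{u₋}` attached to an integer vector `u`. -/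
def latticeBinomial (K : Type) [CommRing K] {σ : Type} [Fintype σ] (u : σ → ℤ) :
    MvPolynomial σ K :=
  (∏ i, (X i) ^ (u i).toNat) - ∏ i, (X i) ^ (-(u i)).toNat

/-- The lattice ideal attached to a set `L` of integer vectors. -/
def latticeIdeal (K : Type) [CommRing K] {σ : Type} [Fintype σ] (L : Set (σ → ℤ)) :
    Ideal (MvPolynomial σ K) :=
  Ideal.span (latticeBinomial K '' L)

/-- A module over a (not necessarily local) ring is Cohen–Macaulay if all its
localizations at primes are. -/
def IsCMModAll (R : Type) [CommRing R] (M : Type) [AddCommGroup M] [Module R M] : Prop :=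
  ∀ (P : Ideal R) (_ : P.IsPrime),
    IsCM (Localization.AtPrime P) (LocalizedModule P.primeCompl M)

set_option linter.unusedSectionVars false
set_option linter.unusedVariables false
set_option linter.unusedSimpArgs false

namespace Pf

lemma wb_cancel {a b : WithBot ℕ∞} (k : ℕ) (h : a + k ≤ b + k) : a ≤ b := by
  induction a using WithBot.recBotCoe with
  | bot => exact bot_le
  | coe a =>
    induction b using WithBot.recBotCoe with
    | bot =>
      exfalso
      rw [WithBot.bot_add, le_bot_iff] at h
      exact WithBot.coe_ne_bot (a := a + (k : ℕ∞)) h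
    | coe b =>
      have h' : a + (k : ℕ∞) ≤ b + (k : ℕ∞) := WithBot.coe_le_coe.mp h
      exact WithBot.coe_le_coe.mpr ((ENat.add_le_add_iff_right (ENat.natCast_ne_top k)).mp h')

set_option maxHeartbeats 1000000 in
open RingTheory.Sequence IsLocalRing in
lemma reg_aux : ∀ (n : ℕ) (S : Type) [CommRing S] [IsLocalRing S] [IsNoetherianRing S],
    ringKrullDim S = n → (∃ s : Finset S, s.card ≤ n ∧ maximalIdeal S = Ideal.span (s : Set S)) →
    IsDomain S ∧ ∃ rs : List S, rs.length = n ∧ (∀ r ∈ rs, r ∈ maximalIdeal S) ∧ IsRegular S rs := by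
  intro n
  induction n with
  | zero =>
    rintro S _ _ _ hdim ⟨s, hs, hm⟩
    have h0 : s = ∅ := by simpa using hs
    subst h0
    have hb : maximalIdeal S = ⊥ := by rw [hm]; simp
    have hf : IsField S := (IsLocalRing.isField_iff_maximalIdeal_eq).mpr hb
    refine ⟨hf.isDomain, [], rfl, by simp, ?_⟩
    exact IsRegular.nil S S
  | succ n ih =>
    rintro S _ _ _ hdim ⟨s, hs, hm⟩
    have hht : ((maximalIdeal S).height : WithBot ℕ∞) = ((n + 1 : ℕ) : ℕ∞) := by
      rw [IsLocalRing.maximalIdeal_height_eq_ringKrullDim, hdim]; rfl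
    have hht' : (maximalIdeal S).height = ((n + 1 : ℕ) : ℕ∞) := by exact_mod_cast hht
    obtain ⟨x, hxm, hx2, hxmin⟩ : ∃ x ∈ maximalIdeal S, x ∉ (maximalIdeal S) ^ 2 ∧
        ∀ q ∈ minimalPrimes S, x ∉ q := by
      by_contra! hcon
      have hfin : (minimalPrimes S).Finite := minimalPrimes.finite_of_isNoetherianRing S
      have hsub : ((maximalIdeal S : Ideal S) : Set S) ⊆
          ⋃ i ∈ (↑(insert ((maximalIdeal S) ^ 2) hfin.toFinset) : Set (Ideal S)), (i : Set S) := by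
        intro x hx
        by_cases hx2 : x ∈ (maximalIdeal S) ^ 2
        · exact Set.mem_biUnion (by simp) hx2
        · obtain ⟨q, hq, hxq⟩ := hcon x hx hx2
          exact Set.mem_biUnion (x := q) (by simp [hq]) hxq
      classical
      have := (Ideal.subset_union_prime (R := S) (f := id)
        (s := insert ((maximalIdeal S) ^ 2) hfin.toFinset) ((maximalIdeal S) ^ 2)
          ((maximalIdeal S) ^ 2) (by
            intro i hi hne _
            simp only [Finset.mem_insert, Set.Finite.mem_toFinset] at hi
            rcases hi with hi | hi
            · exact absurd hi hne
            · exact hi.1.1) (I := maximalIdeal S)).1 (by simpa using hsub)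
      obtain ⟨i, hi, hle⟩ := this
      simp only [Finset.mem_insert, Set.Finite.mem_toFinset, id] at hi hle
      rcases hi with rfl | hi
      · have : maximalIdeal S = ⊥ := by
          apply Submodule.eq_bot_of_le_smul_of_le_jacobson_bot (maximalIdeal S) _
            (IsNoetherian.noetherian _)
          · rw [smul_eq_mul, ← pow_two]; exact hle
          · exact IsLocalRing.maximalIdeal_le_jacobson _
        rw [this] at hht'
        have h2 := Ideal.height_le_spanFinrank (⊥ : Ideal S) (by exact bot_ne_top)
        rw [hht', Submodule.spanFinrank_bot] at h2
        simp at h2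
      · have hp := hi.1.1
        have h3 : maximalIdeal S ∈ minimalPrimes S := by
          have : maximalIdeal S = i := le_antisymm hle (IsLocalRing.le_maximalIdeal hp.ne_top)
          rwa [this]
        have h4 : (maximalIdeal S).height = 0 := by
          rw [Ideal.height_eq_zero_iff]
          exact h3
        rw [hht'] at h4
        simp at h4
    -- generators
    have hne : Ideal.span {x} ≠ ⊤ := by
      intro h
      have : Ideal.span {x} ≤ maximalIdeal S := by rwa [Ideal.span_singleton_le_iff_mem]
      rw [h, top_le_iff] at this
      exact (maximalIdeal.isMaximal S).ne_top this
    have : Nontrivial (S ⧸ Ideal.span {x}) := Ideal.Quotient.nontrivial_iff.mpr hne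
    have : IsLocalRing (S ⧸ Ideal.span {x}) :=
      IsLocalRing.of_surjective' (Ideal.Quotient.mk (Ideal.span {x})) Ideal.Quotient.mk_surjective
    have hmap : (maximalIdeal S).map (Ideal.Quotient.mk (Ideal.span {x})) =
        maximalIdeal (S ⧸ Ideal.span {x}) := by
      rcases Ideal.map_eq_top_or_isMaximal_of_surjective (Ideal.Quotient.mk (Ideal.span {x}))
        Ideal.Quotient.mk_surjective (maximalIdeal.isMaximal S) with h | h
      · exfalso
        have hk : RingHom.ker (Ideal.Quotient.mk (Ideal.span {x})) ≤ maximalIdeal S := by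
          rw [Ideal.mk_ker]; rwa [Ideal.span_singleton_le_iff_mem]
        have h' := Ideal.comap_map_of_surjective' (Ideal.Quotient.mk (Ideal.span {x}))
          Ideal.Quotient.mk_surjective (maximalIdeal S)
        rw [h, Ideal.comap_top, sup_eq_left.mpr hk] at h'
        exact (maximalIdeal.isMaximal S).ne_top h'.symm
      · exact IsLocalRing.eq_maximalIdeal h
    classical
    have hgen : ∃ t : Finset (S ⧸ Ideal.span {x}), t.card ≤ n ∧
        maximalIdeal (S ⧸ Ideal.span {x}) = Ideal.span (t : Set _) := by
      have hx' := hxm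
      rw [hm] at hx'
      obtain ⟨r, -, hr⟩ := Submodule.mem_span_finset.mp hx'
      obtain ⟨y, hy, hry⟩ : ∃ y ∈ s, r y ∉ maximalIdeal S := by
        by_contra! hcon
        apply hx2
        rw [← hr, pow_two]
        refine Submodule.sum_mem _ fun a ha => ?_
        exact Ideal.mul_mem_mul (hcon a ha) (by rw [hm]; exact Ideal.subset_span ha)
      refine ⟨(s.erase y).image (Ideal.Quotient.mk _), ?_, ?_⟩
      · refine Finset.card_image_le.trans ?_
        rw [Finset.card_erase_of_mem hy]; omega
      · rw [← hmap, hm, Ideal.map_span, Finset.coe_image]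
        apply le_antisymm
        · rw [Ideal.span_le]
          rintro _ ⟨z, hz, rfl⟩
          by_cases hzy : z = y
          · subst hzy
            have hu : IsUnit (r z) := by
              by_contra h; exact hry ((mem_maximalIdeal _).mpr h)
            obtain ⟨u, hu⟩ := hu
            have e1 : Ideal.Quotient.mk (Ideal.span {x}) (r z * z) =
                - ∑ a ∈ s.erase z, Ideal.Quotient.mk (Ideal.span {x}) (r a * a) := by
              rw [← Finset.add_sum_erase _ _ hy] at hr
              have : r z * z = x - ∑ a ∈ s.erase z, r a * a := by
                rw [← hr]; simp
              rw [this, map_sub, Ideal.Quotient.eq_zero_iff_mem.mpr (Ideal.mem_span_singleton_self x),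
                map_sum, zero_sub]
            have e2 : Ideal.Quotient.mk (Ideal.span {x}) z =
              Ideal.Quotient.mk (Ideal.span {x}) (↑u⁻¹) *
                Ideal.Quotient.mk (Ideal.span {x}) (r z * z) := by
              rw [← map_mul, ← mul_assoc, ← hu, Units.inv_mul, one_mul]
            rw [SetLike.mem_coe, e2, e1]
            apply Ideal.mul_mem_left
            apply neg_mem
            refine Submodule.sum_mem _ fun a ha => ?_
            rw [map_mul]
            exact Ideal.mul_mem_left _ _ (Ideal.subset_span ⟨a, ha, rfl⟩)
          · exact Ideal.subset_span ⟨z, by simp [hzy]; exact hz, rfl⟩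
        · apply Ideal.span_mono
          apply Set.image_mono
          exact Finset.coe_subset.mpr (Finset.erase_subset _ _)
    have hdimq : ringKrullDim (S ⧸ Ideal.span {x}) = n := by
      obtain ⟨t, ht, htm⟩ := hgen
      apply le_antisymm
      · refine (ringKrullDim_le_spanFinrank_maximalIdeal _).trans ?_
        rw [htm]
        have := Submodule.spanFinrank_span_le_ncard_of_finite (R := S ⧸ Ideal.span {x}) t.finite_toSet
        rw [Set.ncard_coe_finset] at this
        exact Nat.cast_le.mpr (this.trans ht)
      · have h := ringKrullDim_le_ringKrullDim_quotient_add_spanFinrank (Ideal.span {x}) (by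
          rw [Ideal.span_singleton_le_iff_mem, IsLocalRing.ringJacobson_eq_maximalIdeal]
          exact hxm)
        rw [hdim] at h
        have h1 : (Ideal.span {x}).spanFinrank ≤ 1 := by
          have := Submodule.spanFinrank_span_le_ncard_of_finite (R := S) (Set.finite_singleton x)
          simpa using this
        have h2 : ((n + 1 : ℕ) : WithBot ℕ∞) ≤ ringKrullDim (S ⧸ Ideal.span {x}) + 1 := by
          refine h.trans ?_
          gcongr
          exact_mod_cast (Nat.cast_le (α := WithBot ℕ∞)).mpr h1
        have h3 : ((n : WithBot ℕ∞)) + 1 ≤ ringKrullDim (S ⧸ Ideal.span {x}) + 1 := by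
          simpa using h2
        exact wb_cancel 1 (by simpa using h3)
    obtain ⟨hdom, rs, hlen, hmem, hreg⟩ := ih (S ⧸ Ideal.span {x}) hdimq hgen
    have hprime : (Ideal.span {x}).IsPrime := (Ideal.Quotient.isDomain_iff_prime _).mp hdom
    obtain ⟨q, hq, hqx⟩ := Ideal.exists_minimalPrimes_le (I := ⊥) (J := Ideal.span {x}) bot_le
    have hqb : q = ⊥ := by
      apply Submodule.eq_bot_of_le_smul_of_le_jacobson_bot (Ideal.span {x}) _
            (IsNoetherian.noetherian _)
      · intro z hz
        obtain ⟨w, rfl⟩ := Ideal.mem_span_singleton'.mp (hqx hz)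
        have hw : w ∈ q := (hq.1.1.mem_or_mem hz).resolve_right (hxmin q hq)
        rw [mul_comm]
        exact Ideal.mul_mem_mul (Ideal.mem_span_singleton_self x) hw
      · rw [Ideal.span_singleton_le_iff_mem]
        exact IsLocalRing.maximalIdeal_le_jacobson _ hxm
    have hdomS : IsDomain S := by
      have h1 := hq.1.1
      rw [hqb] at h1
      exact @IsDomain.of_bot_isPrime S _ h1
    refine ⟨hdomS, ?_⟩
    have hx0 : x ≠ 0 := fun h => hxmin q hq (by rw [h]; exact zero_mem _)
    obtain ⟨f, hf⟩ : ∃ f : (S ⧸ Ideal.span {x}) → S, ∀ y, Ideal.Quotient.mk _ (f y) = y :=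
      ⟨_, Function.surjInv_eq Ideal.Quotient.mk_surjective⟩
    have hrs : rs = (rs.map f).map (algebraMap S (S ⧸ Ideal.span {x})) := by
      rw [List.map_map]
      conv_lhs => rw [← List.map_id rs]
      apply List.map_congr_left
      intro a _
      exact (hf a).symm
    have hmem' : ∀ r ∈ x :: rs.map f, r ∈ maximalIdeal S := by
      intro r hr
      rcases List.mem_cons.mp hr with rfl | hr
      · exact hxm
      · obtain ⟨a, ha, rfl⟩ := List.mem_map.mp hr
        have h1 := hmem a ha
        rw [mem_maximalIdeal, mem_nonunits_iff] at h1 ⊢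
        intro hu
        apply h1
        rw [← hf a]
        exact hu.map _
    refine ⟨x :: rs.map f, by simp [hlen], hmem', ?_⟩
    rw [IsLocalRing.isRegular_iff_isWeaklyRegular_of_subset_maximalIdeal hmem']
    rw [isWeaklyRegular_cons_iff]
    refine ⟨?_, ?_⟩
    · intro a b hab
      exact mul_left_cancel₀ hx0 hab
    · have h1 : IsWeaklyRegular (S ⧸ Ideal.span {x}) (rs.map f) := by
        rw [← isWeaklyRegular_map_algebraMap_iff (S ⧸ Ideal.span {x}) (S ⧸ Ideal.span {x}) (rs.map f),
          ← hrs]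
        exact hreg.toIsWeaklyRegular
      have e : QuotSMulTop x S ≃ₗ[S] (S ⧸ Ideal.span {x}) := by
        refine Submodule.quotEquivOfEq _ _ ?_
        ext z
        rw [Submodule.mem_smul_pointwise_iff_exists, Ideal.mem_span_singleton]
        constructor
        · rintro ⟨b, -, rfl⟩; exact ⟨b, rfl⟩
        · rintro ⟨b, rfl⟩; exact ⟨b, trivial, rfl⟩
      exact (LinearEquiv.isWeaklyRegular_congr e _).mpr h1

end Pf

namespace Pf

section DGE
variable (S : Type) [CommRing S] [IsLocalRing S]

/-- depth at least n via vanishing of Ext from the residue field -/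
def DGE (n : ℕ) (M : Type) [AddCommGroup M] [Module S M] : Prop :=
  ∀ i < n, Subsingleton (Abelian.Ext (ModuleCat.of S (IsLocalRing.ResidueField S))
    (ModuleCat.of S M) i)

variable {S}
variable {M₁ M₂ M₃ : Type} [AddCommGroup M₁] [Module S M₁] [AddCommGroup M₂] [Module S M₂]
  [AddCommGroup M₃] [Module S M₃]

lemma DGE.mono {n m : ℕ} (h : DGE S n M₁) (hm : m ≤ n) : DGE S m M₁ :=
  fun i hi => h i (lt_of_lt_of_le hi hm)

lemma ses {f : M₁ →ₗ[S] M₂} {g : M₂ →ₗ[S] M₃} (hf : Function.Injective f)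
    (hfg : Function.Exact f g) (hg : Function.Surjective g) :
    (ShortComplex.mk (ModuleCat.ofHom f) (ModuleCat.ofHom g) (by
      ext x; exact hfg.apply_apply_eq_zero x)).ShortExact :=
  ModuleCat.shortComplex_shortExact _ hfg hf hg

lemma DGE.mid {f : M₁ →ₗ[S] M₂} {g : M₂ →ₗ[S] M₃} (hf : Function.Injective f)
    (hfg : Function.Exact f g) (hg : Function.Surjective g) {n : ℕ} (h1 : DGE S n M₁)
    (h3 : DGE S n M₃) : DGE S n M₂ := by
  intro i hi
  have := h1 i hi
  have := h3 i hi
  refine subsingleton_of_forall_eq 0 fun x => ?_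
  obtain ⟨y, rfl⟩ := Abelian.Ext.covariant_sequence_exact₂ _ (ses hf hfg hg) x
    (Subsingleton.elim (α := Abelian.Ext _ (ModuleCat.of S M₃) i) _ _)
  rw [Subsingleton.elim (α := Abelian.Ext _ (ModuleCat.of S M₁) i) y 0]
  simp

lemma DGE.right {f : M₁ →ₗ[S] M₂} {g : M₂ →ₗ[S] M₃} (hf : Function.Injective f)
    (hfg : Function.Exact f g) (hg : Function.Surjective g) {n : ℕ} (h1 : DGE S n M₁)
    (h2 : DGE S (n - 1) M₂) : DGE S (n - 1) M₃ := by
  intro i hi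
  have := h1 (i + 1) (by omega)
  have := h2 i hi
  refine subsingleton_of_forall_eq 0 fun x => ?_
  obtain ⟨y, rfl⟩ := Abelian.Ext.covariant_sequence_exact₃ _ (ses hf hfg hg) x rfl
    (Subsingleton.elim (α := Abelian.Ext _ (ModuleCat.of S M₁) (i + 1)) _ _)
  rw [Subsingleton.elim (α := Abelian.Ext _ (ModuleCat.of S M₂) i) y 0]
  simp

lemma DGE.left {f : M₁ →ₗ[S] M₂} {g : M₂ →ₗ[S] M₃} (hf : Function.Injective f)
    (hfg : Function.Exact f g) (hg : Function.Surjective g) {n : ℕ} (h2 : DGE S n M₂)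
    (h3 : DGE S (n - 1) M₃) : DGE S n M₁ := by
  intro i hi
  have := h2 i hi
  refine subsingleton_of_forall_eq 0 fun x => ?_
  cases i with
  | zero =>
    have hm : Mono (ModuleCat.ofHom f) := (ModuleCat.mono_iff_injective _).mpr hf
    apply Abelian.Ext.postcomp_mk₀_injective_of_mono _ (ModuleCat.ofHom f)
    exact Subsingleton.elim (α := Abelian.Ext _ (ModuleCat.of S M₂) 0) _ _
  | succ i =>
    have := h3 i (by omega)
    obtain ⟨y, rfl⟩ := Abelian.Ext.covariant_sequence_exact₁ _ (ses hf hfg hg) x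
      (Subsingleton.elim (α := Abelian.Ext _ (ModuleCat.of S M₂) (i + 1)) _ _) rfl
    rw [Subsingleton.elim (α := Abelian.Ext _ (ModuleCat.of S M₃) i) y 0]
    simp

lemma DGE.of_subsingleton [Subsingleton M₁] (n : ℕ) : DGE S n M₁ := by
  intro i hi
  refine subsingleton_of_forall_eq 0 fun x => ?_
  have h := Abelian.Ext.comp_mk₀_id x
  have h0 : 𝟙 (ModuleCat.of S M₁) = 0 := by
    ext y; exact Subsingleton.elim (α := M₁) _ _
  rw [← h, h0]
  simp

lemma DGE.congr {n : ℕ} (h : DGE S n M₁) (e : M₁ ≃ₗ[S] M₂) : DGE S n M₂ := by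
  have h0 : DGE S n PUnit := DGE.of_subsingleton n
  exact DGE.mid (f := e.toLinearMap) (g := (0 : M₂ →ₗ[S] PUnit)) e.injective
    (fun y => ⟨fun _ => e.surjective y, fun _ => rfl⟩) (fun y => ⟨0, rfl⟩) h h0

lemma DGE.prod {n : ℕ} (h : DGE S n M₁) (h' : DGE S n M₂) : DGE S n (M₁ × M₂) :=
  DGE.mid (f := LinearMap.inl S M₁ M₂) (g := LinearMap.snd S M₁ M₂) LinearMap.inl_injective
    Function.Exact.inl_snd LinearMap.snd_surjective h h'

end DGE

section DP
variable {R : Type} [CommRing R] (P : Ideal R) [P.IsPrime]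

/-- depth at least n after localizing -/
def DP (n : ℕ) (M : Type) [AddCommGroup M] [Module R M] : Prop :=
  DGE (Localization.AtPrime P) n (LocalizedModule P.primeCompl M)

variable {P}
variable {M₁ M₂ M₃ : Type} [AddCommGroup M₁] [Module R M₁] [AddCommGroup M₂] [Module R M₂]
  [AddCommGroup M₃] [Module R M₃]

lemma DP.mono {n m : ℕ} (h : DP P n M₁) (hm : m ≤ n) : DP P m M₁ := DGE.mono h hm

lemma DP.mid {f : M₁ →ₗ[R] M₂} {g : M₂ →ₗ[R] M₃} (hf : Function.Injective f)
    (hfg : Function.Exact f g) (hg : Function.Surjective g) {n : ℕ} (h1 : DP P n M₁)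
    (h3 : DP P n M₃) : DP P n M₂ :=
  DGE.mid (f := LocalizedModule.map P.primeCompl f) (g := LocalizedModule.map P.primeCompl g)
    (LocalizedModule.map_injective _ _ hf) (LocalizedModule.map_exact _ _ _ hfg)
    (LocalizedModule.map_surjective _ _ hg) h1 h3

lemma DP.right {f : M₁ →ₗ[R] M₂} {g : M₂ →ₗ[R] M₃} (hf : Function.Injective f)
    (hfg : Function.Exact f g) (hg : Function.Surjective g) {n : ℕ} (h1 : DP P n M₁)
    (h2 : DP P (n - 1) M₂) : DP P (n - 1) M₃ :=
  DGE.right (f := LocalizedModule.map P.primeCompl f) (g := LocalizedModule.map P.primeCompl g)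
    (LocalizedModule.map_injective _ _ hf) (LocalizedModule.map_exact _ _ _ hfg)
    (LocalizedModule.map_surjective _ _ hg) h1 h2

lemma DP.left {f : M₁ →ₗ[R] M₂} {g : M₂ →ₗ[R] M₃} (hf : Function.Injective f)
    (hfg : Function.Exact f g) (hg : Function.Surjective g) {n : ℕ} (h2 : DP P n M₂)
    (h3 : DP P (n - 1) M₃) : DP P n M₁ :=
  DGE.left (f := LocalizedModule.map P.primeCompl f) (g := LocalizedModule.map P.primeCompl g)
    (LocalizedModule.map_injective _ _ hf) (LocalizedModule.map_exact _ _ _ hfg)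
    (LocalizedModule.map_surjective _ _ hg) h2 h3

lemma DP.of_subsingleton_loc [Subsingleton (LocalizedModule P.primeCompl M₁)] (n : ℕ) : DP P n M₁ :=
  DGE.of_subsingleton n

lemma DP.of_subsingleton [Subsingleton M₁] (n : ℕ) : DP P n M₁ :=
  DGE.of_subsingleton n

lemma DP.congr {n : ℕ} (h : DP P n M₁) (e : M₁ ≃ₗ[R] M₂) : DP P n M₂ := by
  have h0 : DP P n PUnit := DP.of_subsingleton n
  exact DP.mid (f := e.toLinearMap) (g := (0 : M₂ →ₗ[R] PUnit)) e.injective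
    (fun y => ⟨fun _ => e.surjective y, fun _ => rfl⟩) (fun y => ⟨0, rfl⟩) h h0

lemma DP.prod {n : ℕ} (h : DP P n M₁) (h' : DP P n M₂) : DP P n (M₁ × M₂) :=
  DP.mid (f := LinearMap.inl R M₁ M₂) (g := LinearMap.snd R M₁ M₂) LinearMap.inl_injective
    Function.Exact.inl_snd LinearMap.snd_surjective h h'

lemma DP.quot_list (rs : List R) : ∀ {n : ℕ} (M : Type) [AddCommGroup M] [Module R M],
    DP P n M → RingTheory.Sequence.IsWeaklyRegular M rs →
    DP P (n - rs.length) (M ⧸ (Ideal.ofList rs • ⊤ : Submodule R M)) := by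
  induction rs with
  | nil =>
    intro n M _ _ h _
    refine DP.congr (M₁ := M) (by simpa using h) ?_
    refine (Submodule.quotEquivOfEqBot _ ?_).symm
    simp
  | cons x rs ih =>
    intro n M _ _ h hreg
    rw [RingTheory.Sequence.isWeaklyRegular_cons_iff] at hreg
    have h1 : DP P (n - 1) (QuotSMulTop x M) := by
      refine DP.right (f := LinearMap.lsmul R M x) (g := Submodule.mkQ _) hreg.1 ?_
        (Submodule.mkQ_surjective _) h (h.mono (by omega))
      intro y
      rw [Submodule.mkQ_apply, Submodule.Quotient.mk_eq_zero,
        Submodule.mem_smul_pointwise_iff_exists]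
      simp
    have h2 := ih (QuotSMulTop x M) h1 hreg.2
    rw [List.length_cons, show n - (rs.length + 1) = n - 1 - rs.length by omega]
    exact h2.congr (Submodule.quotOfListConsSMulTopEquivQuotSMulTopInner M x rs).symm

variable (P) in
/-- the linear equivalence -/
def locSelf : LocalizedModule P.primeCompl R ≃ₗ[Localization.AtPrime P] Localization.AtPrime P :=
  LinearEquiv.extendScalarsOfIsLocalization P.primeCompl (Localization.AtPrime P)
    (IsLocalizedModule.iso P.primeCompl (Algebra.linearMap R (Localization.AtPrime P)))

open IsLocalRing in
lemma smul_lt_top {S : Type} [CommRing S] [IsLocalRing S] (M : Type) [AddCommGroup M] [Module S M]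
    [Module.Finite S M] [Nontrivial M] : maximalIdeal S • (⊤ : Submodule S M) < ⊤ := by
  rw [lt_top_iff_ne_top]
  intro h
  have := Submodule.eq_bot_of_le_smul_of_le_jacobson_bot (maximalIdeal S) (⊤ : Submodule S M)
    Module.Finite.fg_top h.ge (IsLocalRing.maximalIdeal_le_jacobson _)
  exact top_ne_bot this

open IsLocalRing in
lemma supp_residue (S : Type) [CommRing S] [IsLocalRing S] :
    Module.support S (ResidueField S) = PrimeSpectrum.zeroLocus (maximalIdeal S : Set S) := by
  rw [Module.support_eq_zeroLocus]
  congr 2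
  exact Ideal.annihilator_quotient

lemma DP_self [IsRegularLocalRing (Localization.AtPrime P)] {c : ℕ}
    (hc : ringKrullDim (Localization.AtPrime P) = c) : DP P c R := by
  have h := reg_aux c (Localization.AtPrime P) hc (by
    have h1 := IsRegularLocalRing.spanFinrank_maximalIdeal (R := Localization.AtPrime P)
    rw [hc] at h1
    have h1' : (IsLocalRing.maximalIdeal (Localization.AtPrime P)).spanFinrank = c := by
      exact_mod_cast h1
    obtain ⟨s, hs, hs'⟩ := Submodule.FG.exists_span_finset_card_eq_spanFinrank
      (IsNoetherian.noetherian (IsLocalRing.maximalIdeal (Localization.AtPrime P)))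
    exact ⟨s, by rw [hs, h1'], hs'.symm⟩)
  obtain ⟨-, rs, hlen, hmem, hreg⟩ := h
  refine DGE.congr (M₁ := Localization.AtPrime P) ?_ (locSelf P).symm
  intro i hi
  exact ModuleCat.subsingleton_ext_of_exists_isRegular
    (IsLocalRing.maximalIdeal (Localization.AtPrime P))
    (ModuleCat.of _ (IsLocalRing.ResidueField (Localization.AtPrime P)))
    (supp_residue _).le (ModuleCat.of _ (Localization.AtPrime P))
    (smul_lt_top _) rs hmem hreg i (by omega)

end DP

end Pf

namespace Pf
open IsLocalRing RingTheory.Sequence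

section
variable {S : Type} [CommRing S] [IsLocalRing S] [IsNoetherianRing S]
variable (M : Type) [AddCommGroup M] [Module S M] [Module.Finite S M] [Nontrivial M]

lemma depth_ge {n : ℕ} (h : DGE S n M) : (n : ℕ∞) ≤ moduleDepth S M := by
  obtain ⟨rs, hlen, hmem, hreg⟩ := ModuleCat.exists_isRegular_of_exists_subsingleton_ext
    (maximalIdeal S) n (ModuleCat.of S M) (smul_lt_top M) (ModuleCat.of S (ResidueField S))
    (supp_residue S) h
  exact le_sSup ⟨rs, by rw [hlen], hmem, hreg⟩

lemma DGE_of_depth {n : ℕ} (h : (n : ℕ∞) ≤ moduleDepth S M) : DGE S n M := by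
  intro i hi
  have h1 : (i : ℕ∞) < moduleDepth S M := lt_of_lt_of_le (by exact_mod_cast hi) h
  obtain ⟨m, ⟨rs, hlen, hmem, hreg⟩, hm⟩ := lt_sSup_iff.mp h1
  exact ModuleCat.subsingleton_ext_of_exists_isRegular (maximalIdeal S)
    (ModuleCat.of S (ResidueField S)) (supp_residue S).le (ModuleCat.of S M) (smul_lt_top M)
    rs hmem hreg i (by rw [← hlen] at hm; exact_mod_cast hm)

lemma length_le_dim {rs : List S} (hreg : IsRegular M rs) :
    ((rs.length : ℕ∞) : WithBot ℕ∞) ≤ Module.supportDim S M := by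
  rw [← Module.supportDim_add_length_eq_supportDim_of_isRegular rs hreg]
  have hnt : Nontrivial (M ⧸ (Ideal.ofList rs • ⊤ : Submodule S M)) :=
    Submodule.Quotient.nontrivial_iff.mpr (Ne.symm hreg.top_ne_smul)
  have : 0 ≤ Module.supportDim S (M ⧸ (Ideal.ofList rs • ⊤ : Submodule S M)) := by
    by_contra h
    rw [not_le] at h
    have := Module.supportDim_ne_bot_of_nontrivial S (M ⧸ (Ideal.ofList rs • ⊤ : Submodule S M))
    apply this
    exact WithBot.lt_coe_bot.mp (by simpa using h)
  calc ((rs.length : ℕ∞) : WithBot ℕ∞) = 0 + rs.length := by simp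
    _ ≤ _ := by gcongr

lemma depth_le_dim : (moduleDepth S M : WithBot ℕ∞) ≤ moduleDim S M := by
  obtain ⟨D, hD⟩ : ∃ D : ℕ∞, Module.supportDim S M = D := by
    have := Module.supportDim_ne_bot_of_nontrivial S M
    exact ⟨_, (WithBot.coe_unbot _ this).symm⟩
  change _ ≤ Module.supportDim S M
  rw [hD, WithBot.coe_le_coe]
  apply sSup_le
  rintro _ ⟨rs, rfl, -, hreg⟩
  have := length_le_dim M hreg
  rw [hD] at this
  exact WithBot.coe_le_coe.mp this

lemma cm_of_le {n : ℕ} (h : DGE S n M) (h2 : moduleDim S M ≤ n) :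
    moduleDim S M = (moduleDepth S M : WithBot ℕ∞) := by
  apply le_antisymm _ (depth_le_dim M)
  refine h2.trans ?_
  exact WithBot.coe_le_coe.mpr (depth_ge M h)

end

lemma dim_le_of_kill {S : Type} [CommRing S] {M : Type} [AddCommGroup M] [Module S M]
    (I : Ideal S) (hI : ∀ r ∈ I, ∀ m : M, r • m = 0) [Module.Finite S M]: 
    Module.supportDim S M ≤ ringKrullDim (S ⧸ I) := by
  rw [Module.supportDim_eq_ringKrullDim_quotient_annihilator]
  refine ringKrullDim_le_of_surjective (Ideal.Quotient.factor (S := I) (T := Module.annihilator S M) ?_)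
    (Ideal.Quotient.factor_surjective _)
  intro r hr
  exact Module.mem_annihilator.mpr (hI r hr)

lemma wb_eq_of_add {x : WithBot ℕ∞} {k c : ℕ} (h : x + k = c) : x = ((c - k : ℕ) : WithBot ℕ∞) ∧ k ≤ c := by
  induction x using WithBot.recBotCoe with
  | bot =>
    exfalso
    rw [WithBot.bot_add] at h
    exact WithBot.coe_ne_bot (a := (c : ℕ∞)) h.symm
  | coe x =>
    have h' : x + (k : ℕ∞) = (c : ℕ∞) := WithBot.coe_inj.mp h
    induction x using ENat.recTopCoe with
    | top => simp at h'
    | coe x =>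
      have h'' : x + k = c := by exact_mod_cast h'
      refine ⟨?_, by omega⟩
      have : x = c - k := by omega
      rw [this]; rfl

section
variable {R : Type} [CommRing R] (P : Ideal R) [P.IsPrime]
variable {M : Type} [AddCommGroup M] [Module R M]

instance [Module.Finite R M] :
    Module.Finite (Localization.AtPrime P) (LocalizedModule P.primeCompl M) :=
  Module.Finite.of_isLocalizedModule P.primeCompl (LocalizedModule.mkLinearMap P.primeCompl M)

lemma mem_of_kill {r : R} (hr : ∀ m : M, r • m = 0)
    (hM : ¬ Subsingleton (LocalizedModule P.primeCompl M)) : r ∈ P := by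
  by_contra h
  apply hM
  rw [LocalizedModule.subsingleton_iff]
  intro m
  exact ⟨r, h, hr m⟩

lemma kill_loc {r : R} (hr : ∀ m : M, r • m = 0) (m : LocalizedModule P.primeCompl M) :
    algebraMap R (Localization.AtPrime P) r • m = 0 := by
  induction m using LocalizedModule.induction_on with
  | h m s =>
    rw [algebraMap_smul, LocalizedModule.smul'_mk, hr, LocalizedModule.zero_mk]

lemma loc_dim_le [IsNoetherianRing R] [Module.Finite R M] {c : ℕ}
    (hc : ringKrullDim (Localization.AtPrime P) = c)
    {rs : List R} (hrs : IsWeaklyRegular R rs) (hk : ∀ r ∈ rs, ∀ m : M, r • m = 0)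
    (hM : ¬ Subsingleton (LocalizedModule P.primeCompl M)) :
    Module.supportDim (Localization.AtPrime P) (LocalizedModule P.primeCompl M) ≤
      ((c - rs.length : ℕ) : WithBot ℕ∞) ∧ rs.length ≤ c := by
  have hreg := IsWeaklyRegular.isRegular_of_isLocalization_of_mem (Localization.AtPrime P) P hrs
    (fun r hr => mem_of_kill P (hk r hr) hM)
  have h1 := ringKrullDim_add_length_eq_ringKrullDim_of_isRegular _ hreg
  rw [hc, List.length_map] at h1
  obtain ⟨h2, h3⟩ := wb_eq_of_add h1
  rw [← h2]
  refine ⟨dim_le_of_kill _ ?_, h3⟩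
  intro r hr m
  have h4 : Ideal.ofList (rs.map (algebraMap R (Localization.AtPrime P))) ≤
      Module.annihilator (Localization.AtPrime P) (LocalizedModule P.primeCompl M) := by
    refine Ideal.span_le.mpr ?_
    intro x hx
    obtain ⟨y, hy, rfl⟩ := List.mem_map.mp hx
    exact Module.mem_annihilator.mpr (kill_loc P (hk y hy))
  exact Module.mem_annihilator.mp (h4 hr) m

lemma cm_crit [IsNoetherianRing R] [Module.Finite R M] {c : ℕ}
    (hc : ringKrullDim (Localization.AtPrime P) = c)
    {rs : List R} (hrs : IsWeaklyRegular R rs) (hk : ∀ r ∈ rs, ∀ m : M, r • m = 0)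
    (h : DP P (c - rs.length) M) :
    IsCM (Localization.AtPrime P) (LocalizedModule P.primeCompl M) := by
  by_cases hM : Subsingleton (LocalizedModule P.primeCompl M)
  · exact Or.inl hM
  · right
    have : Nontrivial (LocalizedModule P.primeCompl M) := not_subsingleton_iff_nontrivial.mp hM
    exact cm_of_le _ h (loc_dim_le P hc hrs hk hM).1

lemma loc_dim_mono [Module.Finite R M] (I : Ideal R) (hI : ∀ r ∈ I, ∀ m : M, r • m = 0) :
    Module.supportDim (Localization.AtPrime P) (LocalizedModule P.primeCompl M) ≤
    Module.supportDim (Localization.AtPrime P) (LocalizedModule P.primeCompl (R ⧸ I)) := by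
  rw [Module.supportDim_eq_ringKrullDim_quotient_annihilator (Localization.AtPrime P)
    (LocalizedModule P.primeCompl (R ⧸ I))]
  apply dim_le_of_kill
  intro x hx m
  obtain ⟨⟨r, t⟩, rfl⟩ := IsLocalization.mk'_surjective P.primeCompl x
  dsimp only at hx ⊢
  have h1 := Module.mem_annihilator.mp hx (LocalizedModule.mk (1 : R ⧸ I) 1)
  have h2 : algebraMap R (Localization.AtPrime P) r • (LocalizedModule.mk (S := P.primeCompl) (1 : R ⧸ I) 1) = 0 := by
    rw [← IsLocalization.mk'_spec' (Localization.AtPrime P) r t, mul_smul, h1, smul_zero]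
  rw [algebraMap_smul, LocalizedModule.smul'_mk, ← LocalizedModule.zero_mk 1, LocalizedModule.mk_eq] at h2
  obtain ⟨⟨u, hu⟩, hu2⟩ := h2
  simp only [one_smul, smul_zero, Submonoid.mk_smul] at hu2
  have h3 : u * r ∈ I := by
    rw [← Ideal.Quotient.eq_zero_iff_mem]
    rw [← hu2]
    simp [Algebra.smul_def]
  have h4 := kill_loc P (hI _ h3) m
  have hu' : IsUnit (algebraMap R (Localization.AtPrime P) u) :=
    IsLocalization.map_units (Localization.AtPrime P) (⟨u, hu⟩ : P.primeCompl)
  rw [map_mul, ← IsLocalization.mk'_spec' (Localization.AtPrime P) r t, mul_smul, mul_smul,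
    hu'.smul_eq_zero, (IsLocalization.map_units (Localization.AtPrime P) t).smul_eq_zero] at h4
  exact h4

lemma noncm [IsNoetherianRing R] {c : ℕ} (hc : ringKrullDim (Localization.AtPrime P) = c)
    (I : Ideal R) {A' N : Type} [AddCommGroup A'] [Module R A'] [Module.Finite R A']
    [AddCommGroup N] [Module R N] [Module.Finite R N]
    (hI : ∀ r ∈ I, ∀ m : A', r • m = 0)
    {f : (R ⧸ I) →ₗ[R] A'} {g : A' →ₗ[R] N} (hf : Function.Injective f)
    (hfg : Function.Exact f g) (hg : Function.Surjective g)
    (hA' : DP P (c - 2) A') {rs : List R} (hrs : IsWeaklyRegular R rs) (hlen : rs.length = 4)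
    (hk : ∀ r ∈ rs, ∀ m : N, r • m = 0)
    (hN : ¬ Subsingleton (LocalizedModule P.primeCompl N)) :
    ¬ IsCM (Localization.AtPrime P) (LocalizedModule P.primeCompl (R ⧸ I)) := by
  have hNn : Nontrivial (LocalizedModule P.primeCompl N) := not_subsingleton_iff_nontrivial.mp hN
  obtain ⟨h1, h2⟩ := loc_dim_le P hc hrs hk hN
  rw [hlen] at h1 h2
  have hA'n : Nontrivial (LocalizedModule P.primeCompl A') :=
    (LocalizedModule.map_surjective P.primeCompl g hg).nontrivial
  have h3 : ((c - 2 : ℕ) : WithBot ℕ∞) ≤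
      Module.supportDim (Localization.AtPrime P) (LocalizedModule P.primeCompl (R ⧸ I)) :=
    ((WithBot.coe_le_coe.mpr (depth_ge _ hA')).trans (depth_le_dim _)).trans (loc_dim_mono P I hI)
  rintro (hs | hcm)
  · have := Module.supportDim_eq_bot_of_subsingleton (Localization.AtPrime P)
      (LocalizedModule P.primeCompl (R ⧸ I))
    rw [this, le_bot_iff] at h3
    exact WithBot.coe_ne_bot (a := ((c - 2 : ℕ) : ℕ∞)) h3
  · have hAn : Nontrivial (LocalizedModule P.primeCompl (R ⧸ I)) := by
      by_contra hs
      rw [not_nontrivial_iff_subsingleton] at hs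
      have := Module.supportDim_eq_bot_of_subsingleton (Localization.AtPrime P)
        (LocalizedModule P.primeCompl (R ⧸ I))
      rw [this, le_bot_iff] at h3
      exact WithBot.coe_ne_bot (a := ((c - 2 : ℕ) : ℕ∞)) h3
    have h4 : ((c - 2 : ℕ) : ℕ∞) ≤ moduleDepth (Localization.AtPrime P)
        (LocalizedModule P.primeCompl (R ⧸ I)) := by
      have h5 : ((c - 2 : ℕ) : WithBot ℕ∞) ≤ (moduleDepth (Localization.AtPrime P)
        (LocalizedModule P.primeCompl (R ⧸ I)) : WithBot ℕ∞) := by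
        rw [← hcm]; exact h3
      exact WithBot.coe_le_coe.mp h5
    have h5 : DP P (c - 2) (R ⧸ I) := DGE_of_depth _ h4
    have h6 : DP P (c - 2 - 1) N := DP.right hf hfg hg h5 (hA'.mono (by omega))
    have h7 := (WithBot.coe_le_coe.mpr (depth_ge _ h6)).trans (depth_le_dim _)
    have h8 : ((c - 2 - 1 : ℕ) : WithBot ℕ∞) ≤ ((c - 4 : ℕ) : WithBot ℕ∞) := h7.trans h1
    have h9 := Nat.cast_le.mp h8
    omega

lemma serre_of_cm (h : ∀ (P : Ideal R) (_ : P.IsPrime),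
    IsCM (Localization.AtPrime P) (LocalizedModule P.primeCompl M)) : SerreS2 R M := by
  intro P hP
  rcases h P hP with hs | h
  · have : moduleDim (Localization.AtPrime P) (LocalizedModule P.primeCompl M) = ⊥ :=
      Module.supportDim_eq_bot_of_subsingleton (Localization.AtPrime P) _
    rw [this]; exact (min_le_right _ _).trans bot_le
  · rw [h]; exact min_le_right _ _

end
end Pf

namespace Pf

/-- coprimality in syzygy form -/
def Cop {R : Type} [CommRing R] (x y : R) : Prop := ∀ a b, a * x = b * y → ∃ t, a = t * y ∧ b = t * x

/-- The data of the Peskine–Szpiro resolution. -/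
structure Dat (R : Type) [CommRing R] where
  p : R
  q : R
  r : R
  s : R
  e1 : R
  e2 : R
  e3 : R
  e4 : R
  I : Ideal R
  J : Ideal R

namespace Dat
variable {R : Type} [CommRing R] (D : Dat R)

def A : R := D.p * D.r * D.e1 - D.q * D.s * D.e2
def B : R := D.p * D.s * D.e3 - D.q * D.r * D.e4
def F : R := D.p ^ 2 * D.e1 * D.e3 - D.q ^ 2 * D.e2 * D.e4
def G : R := D.r ^ 2 * D.e1 * D.e4 - D.s ^ 2 * D.e2 * D.e3

/-- The facts needed about the data. -/
structure Good : Prop where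
  memI : ∀ ρ, ρ ∈ D.I ↔ ∃ a b f g, ρ = a * D.A + b * D.B + f * D.F + g * D.G
  memJ : ∀ ρ, ρ ∈ D.J ↔ ∃ a b f g, ρ = a * D.p + b * D.q + f * D.r + g * D.s
  wreg : RingTheory.Sequence.IsWeaklyRegular R [D.p, D.q, D.r, D.s]
  pq : Cop D.p D.q
  rs : Cop D.r D.s
  hr : ∀ a b c, a * D.p + b * D.q + c * D.r = 0 → ∃ u v, c = u * D.p + v * D.q
  hs : ∀ a b c d, a * D.p + b * D.q + c * D.r + d * D.s = 0 →
    ∃ u v w, d = u * D.p + v * D.q + w * D.r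
  hAB : ∀ α β, α * D.A + β * D.B = 0 → ∃ t, α = t * D.B ∧ β = - (t * D.A)
  hG : ∀ h a b, h * D.G = a * D.p + b * D.q → ∃ u v, h = u * D.p + v * D.q
  hF : ∀ h a b, h * D.F = a * D.r + b * D.s → ∃ u v, h = u * D.r + v * D.s
  hI : ∀ ρ, ρ * (D.p * D.s) ∈ D.I → ρ ∈ D.I
  A0 : D.A ≠ 0
  B0 : D.B ≠ 0
  p0 : D.p ≠ 0
  q0 : D.q ≠ 0
  r0 : D.r ≠ 0
  s0 : D.s ≠ 0

variable {D}

lemma Good.K1 (hD : D.Good) {a b c d : R} (h : a * D.p + b * D.q + c * D.r + d * D.s = 0) :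
    ∃ cpq cpr cps cqr cqs crs, a = D.q * cpq + D.r * cpr + D.s * cps ∧
      b = - D.p * cpq + D.r * cqr + D.s * cqs ∧ c = - D.p * cpr - D.q * cqr + D.s * crs ∧
      d = - D.p * cps - D.q * cqs - D.r * crs := by
  obtain ⟨u, v, w, rfl⟩ := hD.hs _ _ _ _ h
  have h1 : (a + u * D.s) * D.p + (b + v * D.s) * D.q + (c + w * D.s) * D.r = 0 := by
    linear_combination h
  obtain ⟨x, y, hxy⟩ := hD.hr _ _ _ h1
  have h2 : (a + u * D.s + x * D.r) * D.p = (- (b + v * D.s + y * D.r)) * D.q := by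
    rw [hxy] at h1; linear_combination h1
  obtain ⟨t, ht1, ht2⟩ := hD.pq _ _ h2
  exact ⟨t, -x, -u, -y, -v, -w, by linear_combination ht1, by linear_combination -ht2,
    by linear_combination hxy, by ring⟩

/-- a row of four elements as a functional -/
def row (a b c d : R) : (R × R × R × R) →ₗ[R] R where
  toFun x := x.1 * a + x.2.1 * b + x.2.2.1 * c + x.2.2.2 * d
  map_add' x y := by simp only [Prod.fst_add, Prod.snd_add]; ring
  map_smul' t x := by simp only [Prod.smul_fst, Prod.smul_snd, smul_eq_mul, RingHom.id_apply]; ring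

lemma row_apply (a b c d : R) (x : R × R × R × R) :
    row a b c d x = x.1 * a + x.2.1 * b + x.2.2.1 * c + x.2.2.2 * d := rfl

/-- a column -/
def col (a b c d : R) : R →ₗ[R] (R × R × R × R) where
  toFun t := (t * a, t * b, t * c, t * d)
  map_add' x y := by ext <;> simp <;> ring
  map_smul' t x := by ext <;> simp <;> ring

lemma col_apply (a b c d t : R) : col a b c d t = (t * a, t * b, t * c, t * d) := rfl

variable (D)
def d1 : (R × R × R × R) →ₗ[R] R := row D.A D.B D.F D.G
def d2 : (R × R × R × R) →ₗ[R] (R × R × R × R) :=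
  (row (D.p * D.e3) (D.q * D.e4) (D.r * D.e4) (D.s * D.e3)).prod
   ((row (D.q * D.e2) (D.p * D.e1) (- D.s * D.e2) (- D.r * D.e1)).prod
    ((row (- D.r) (- D.s) 0 0).prod (row 0 0 (- D.p) (- D.q))))
def d3 : R →ₗ[R] (R × R × R × R) := col D.s (- D.r) D.q (- D.p)

def t1 : R →ₗ[R] (R × R × R × R) := col D.A D.B D.F D.G
def t2 : (R × R × R × R) →ₗ[R] (R × R × R × R) :=
  (row (D.p * D.e3) (D.q * D.e2) (- D.r) 0).prod
   ((row (D.q * D.e4) (D.p * D.e1) (- D.s) 0).prod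
    ((row (D.r * D.e4) (- D.s * D.e2) 0 (- D.p)).prod (row (D.s * D.e3) (- D.r * D.e1) 0 (- D.q))))
def t3 : (R × R × R × R) →ₗ[R] R := row D.s (- D.r) D.q (- D.p)

variable {D}

lemma d1_apply (x) : D.d1 x = x.1 * D.A + x.2.1 * D.B + x.2.2.1 * D.F + x.2.2.2 * D.G := rfl
lemma d2_apply (x) : D.d2 x =
    (x.1 * (D.p * D.e3) + x.2.1 * (D.q * D.e4) + x.2.2.1 * (D.r * D.e4) + x.2.2.2 * (D.s * D.e3),
     x.1 * (D.q * D.e2) + x.2.1 * (D.p * D.e1) + x.2.2.1 * (- D.s * D.e2) + x.2.2.2 * (- D.r * D.e1),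
     x.1 * (- D.r) + x.2.1 * (- D.s) + x.2.2.1 * 0 + x.2.2.2 * 0,
     x.1 * 0 + x.2.1 * 0 + x.2.2.1 * (- D.p) + x.2.2.2 * (- D.q)) := rfl
lemma t2_apply (x) : D.t2 x =
    (x.1 * (D.p * D.e3) + x.2.1 * (D.q * D.e2) + x.2.2.1 * (- D.r) + x.2.2.2 * 0,
     x.1 * (D.q * D.e4) + x.2.1 * (D.p * D.e1) + x.2.2.1 * (- D.s) + x.2.2.2 * 0,
     x.1 * (D.r * D.e4) + x.2.1 * (- D.s * D.e2) + x.2.2.1 * 0 + x.2.2.2 * (- D.p),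
     x.1 * (D.s * D.e3) + x.2.1 * (- D.r * D.e1) + x.2.2.1 * 0 + x.2.2.2 * (- D.q)) := rfl
lemma t3_apply (x) : D.t3 x = x.1 * D.s + x.2.1 * (-D.r) + x.2.2.1 * D.q + x.2.2.2 * (-D.p) := rfl

variable [IsDomain R]

lemma Good.ex12 (hD : D.Good) : Function.Exact D.d2 D.d1 := by
  rintro ⟨a, b, f, g⟩
  constructor
  · intro h
    rw [d1_apply] at h
    dsimp only at h
    obtain ⟨κp, κq, hg⟩ := hD.hG g
      (-(a * D.r * D.e1 + b * D.s * D.e3 + f * D.p * D.e1 * D.e3))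
      (a * D.s * D.e2 + b * D.r * D.e4 + f * D.q * D.e2 * D.e4) (by
        unfold A B F at h; linear_combination h)
    obtain ⟨κr, κs, hf⟩ := hD.hF f
      (-(a * D.p * D.e1 - b * D.q * D.e4 + g * D.r * D.e1 * D.e4))
      (a * D.q * D.e2 - b * D.p * D.e3 + g * D.s * D.e2 * D.e3) (by
        unfold A B G at h; linear_combination h)
    have h2 : (a + κr * D.p * D.e3 + κs * D.q * D.e4 + κp * D.r * D.e4 + κq * D.s * D.e3) * D.A +
        (b + κr * D.q * D.e2 + κs * D.p * D.e1 - κp * D.s * D.e2 - κq * D.r * D.e1) * D.B = 0 := by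
      rw [hf, hg] at h
      unfold A B F G at *
      linear_combination h
    obtain ⟨t, ht1, ht2⟩ := hD.hAB _ _ h2
    refine ⟨(-κr + t * D.s, -κs - t * D.r, -κp, -κq), ?_⟩
    rw [d2_apply]
    unfold A B at *
    ext
    · dsimp only; linear_combination -ht1
    · dsimp only; linear_combination -ht2
    · dsimp only; linear_combination -hf
    · dsimp only; linear_combination -hg
  · rintro ⟨x, hx⟩
    rw [← hx, d1_apply, d2_apply]
    unfold A B F G
    ring

lemma Good.ex23 (hD : D.Good) : Function.Exact D.d3 D.d2 := by
  rintro ⟨a, b, f, g⟩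
  constructor
  · intro h
    rw [d2_apply] at h
    simp only [Prod.mk_eq_zero] at h
    obtain ⟨h1, h2, h3, h4⟩ := h
    obtain ⟨t, ht1, ht2⟩ := hD.rs a (-b) (by linear_combination -h3)
    obtain ⟨u, hu1, hu2⟩ := hD.pq f (-g) (by linear_combination -h4)
    have hb : b = - (t * D.r) := by linear_combination -ht2
    have hg : g = - (u * D.p) := by linear_combination -hu2
    have h5 : (t - u) * D.B = 0 := by
      rw [ht1, hb, hu1, hg] at h1
      unfold B
      linear_combination h1
    have h6 : t = u := sub_eq_zero.mp ((mul_eq_zero.mp h5).resolve_right hD.B0)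
    refine ⟨t, ?_⟩
    change ((t * D.s, t * (-D.r), t * D.q, t * (-D.p)) : R × R × R × R) = _
    rw [ht1, hb, hu1, hg, h6]
    simp
  · rintro ⟨x, hx⟩
    rw [← hx, d2_apply, d3, col_apply]
    simp only [Prod.mk_eq_zero]
    refine ⟨by ring, by ring, by ring, by ring⟩

lemma Good.inj3 (hD : D.Good) : Function.Injective D.d3 := by
  rw [injective_iff_map_eq_zero]
  intro t h
  rw [d3, col_apply] at h
  simp only [Prod.mk_eq_zero] at h
  exact (mul_eq_zero.mp h.1).resolve_right hD.s0

lemma Good.tex12 (hD : D.Good) : Function.Exact D.t1 D.t2 := by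
  rintro ⟨a, b, f, g⟩
  constructor
  · intro h
    rw [t2_apply] at h
    simp only [Prod.mk_eq_zero] at h
    obtain ⟨h1, h2, h3, h4⟩ := h
    have h5 : b * D.A + (-a) * D.B = 0 := by
      unfold A B; linear_combination -D.s * h1 + D.r * h2
    obtain ⟨t, ht1, ht2⟩ := hD.hAB _ _ h5
    have ha : a = t * D.A := by linear_combination -ht2
    have hf : f = t * D.F := by
      apply mul_right_cancel₀ hD.r0
      rw [ha, ht1] at h1
      unfold A B F at *
      linear_combination -h1
    have hg : g = t * D.G := by
      apply mul_right_cancel₀ hD.p0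
      rw [ha, ht1] at h3
      unfold A B G at *
      linear_combination -h3
    exact ⟨t, by rw [t1, col_apply, ha, ht1, hf, hg]⟩
  · rintro ⟨x, hx⟩
    rw [← hx, t2_apply, t1, col_apply]
    unfold A B F G
    simp only [Prod.mk_eq_zero]
    refine ⟨by ring, by ring, by ring, by ring⟩

lemma Good.tinj1 (hD : D.Good) : Function.Injective D.t1 := by
  rw [injective_iff_map_eq_zero]
  intro t h
  rw [t1, col_apply] at h
  simp only [Prod.mk_eq_zero] at h
  exact (mul_eq_zero.mp h.1).resolve_right hD.A0

lemma t23 (x) : D.t3 (D.t2 x) = 0 := by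
  rw [t3_apply, t2_apply]; dsimp only; ring

/-- the canonical module -/
abbrev Kmod (D : Dat R) : Type :=
  LinearMap.ker D.t3 ⧸ (LinearMap.range D.t2).comap (LinearMap.ker D.t3).subtype

lemma killA {x} (hx : D.t3 x = 0) : ∃ y, D.t2 y = D.A • x := by
  obtain ⟨a, b, f, g⟩ := x
  rw [t3_apply] at hx
  dsimp only at hx
  refine ⟨(0, - D.s * a + D.r * b, - D.p * D.e1 * a + D.q * D.e2 * b,
    - D.r * D.e1 * f + D.s * D.e2 * g), ?_⟩
  rw [t2_apply]
  unfold A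
  ext
  · simp; ring
  · simp; ring
  · simp; linear_combination (D.s * D.e2) * hx
  · simp; linear_combination (D.r * D.e1) * hx

lemma killB {x} (hx : D.t3 x = 0) : ∃ y, D.t2 y = D.B • x := by
  obtain ⟨a, b, f, g⟩ := x
  rw [t3_apply] at hx
  dsimp only at hx
  refine ⟨(D.s * a - D.r * b, 0, D.q * D.e4 * a - D.p * D.e3 * b,
    - D.s * D.e3 * f + D.r * D.e4 * g), ?_⟩
  rw [t2_apply]
  unfold B
  ext
  · simp; ring
  · simp; ring
  · simp; linear_combination (D.r * D.e4) * hx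
  · simp; linear_combination (D.s * D.e3) * hx

lemma killF {x} (hx : D.t3 x = 0) : ∃ y, D.t2 y = D.F • x := by
  obtain ⟨a, b, f, g⟩ := x
  rw [t3_apply] at hx
  dsimp only at hx
  refine ⟨(D.p * D.e1 * a - D.q * D.e2 * b, - D.q * D.e4 * a + D.p * D.e3 * b, 0,
    D.r * D.e1 * D.e4 * a - D.s * D.e2 * D.e3 * b - D.p * D.e1 * D.e3 * f +
      D.q * D.e2 * D.e4 * g), ?_⟩
  rw [t2_apply]
  unfold F
  ext
  · simp; ring
  · simp; ring
  · simp; linear_combination (D.q * D.e2 * D.e4) * hx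
  · simp; linear_combination (D.p * D.e1 * D.e3) * hx

lemma killG {x} (hx : D.t3 x = 0) : ∃ y, D.t2 y = D.G • x := by
  obtain ⟨a, b, f, g⟩ := x
  rw [t3_apply] at hx
  dsimp only at hx
  refine ⟨(D.r * D.e1 * f - D.s * D.e2 * g, D.s * D.e3 * f - D.r * D.e4 * g,
    -(D.r * D.e1 * D.e4 * a - D.s * D.e2 * D.e3 * b - D.p * D.e1 * D.e3 * f +
      D.q * D.e2 * D.e4 * g), 0), ?_⟩
  rw [t2_apply]
  unfold G
  ext
  · simp; linear_combination (D.s * D.e2 * D.e3) * hx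
  · simp; linear_combination (D.r * D.e1 * D.e4) * hx
  · simp; ring
  · simp; ring

lemma Good.killK (hD : D.Good) {ρ : R} (hρ : ρ ∈ D.I) (m : Kmod D) : ρ • m = 0 := by
  obtain ⟨a, b, f, g, rfl⟩ := (hD.memI ρ).mp hρ
  obtain ⟨⟨x, hx⟩, rfl⟩ := Submodule.Quotient.mk_surjective _ m
  rw [← Submodule.Quotient.mk_smul, Submodule.Quotient.mk_eq_zero, Submodule.mem_comap]
  obtain ⟨y1, h1⟩ := killA hx
  obtain ⟨y2, h2⟩ := killB hx
  obtain ⟨y3, h3⟩ := killF hx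
  obtain ⟨y4, h4⟩ := killG hx
  refine ⟨a • y1 + b • y2 + f • y3 + g • y4, ?_⟩
  simp only [map_add, map_smul, h1, h2, h3, h4, smul_smul, ← add_smul, Submodule.subtype_apply,
    Submodule.coe_smul]

lemma Good.annK (hD : D.Good) {ρ : R} (h : ∀ m : Kmod D, ρ • m = 0) : ρ ∈ D.I := by
  have hk : ((D.p, 0, 0, D.s) : R × R × R × R) ∈ LinearMap.ker D.t3 := by
    rw [LinearMap.mem_ker, t3_apply]; dsimp only; ring
  have h1 := h (Submodule.Quotient.mk ⟨_, hk⟩)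
  rw [← Submodule.Quotient.mk_smul, Submodule.Quotient.mk_eq_zero, Submodule.mem_comap] at h1
  obtain ⟨⟨a, b, f, g⟩, hx⟩ := h1
  rw [t2_apply] at hx
  simp only [Submodule.subtype_apply, Submodule.coe_smul, Prod.smul_mk, smul_eq_mul, Prod.mk.injEq] at hx
  obtain ⟨h1, h2, h3, h4⟩ := hx
  apply hD.hI
  rw [hD.memI]
  refine ⟨-b, a, 0, 0, ?_⟩
  unfold A B
  linear_combination - D.s * h1 + D.r * h2

end Dat
end Pf

namespace Pf
namespace Dat
variable {R : Type} [CommRing R] [IsDomain R] {D : Dat R}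

variable (D) in
def mD : ((R × R × R × R) × (R × R × R × R)) →ₗ[R] R × R :=
  ((row D.A D.B D.F D.G).coprod (row (D.q * D.e2 * D.e4) (D.p * D.e1 * D.e3) (D.s * D.e2 * D.e3)
    (D.r * D.e1 * D.e4))).prod ((row D.p D.q D.r D.s) ∘ₗ LinearMap.snd R _ _)

lemma mD_apply (x k : R × R × R × R) : D.mD (x, k) =
    ((x.1 * D.A + x.2.1 * D.B + x.2.2.1 * D.F + x.2.2.2 * D.G) +
     (k.1 * (D.q * D.e2 * D.e4) + k.2.1 * (D.p * D.e1 * D.e3) + k.2.2.1 * (D.s * D.e2 * D.e3)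
      + k.2.2.2 * (D.r * D.e1 * D.e4)),
     k.1 * D.p + k.2.1 * D.q + k.2.2.1 * D.r + k.2.2.2 * D.s) := rfl

variable (D) in
def mT : ((R × R × R) × (R × R × R)) →ₗ[R] ((R × R × R × R) × (R × R × R × R)) where
  toFun c := ((D.e4 * c.1.2.2 - D.e3 * c.2.1, D.e2 * c.1.2.1 - D.e1 * c.2.2.1, c.1.1, c.2.2.2),
    (D.q * c.1.1 + D.r * c.1.2.1 + D.s * c.1.2.2, - D.p * c.1.1 + D.r * c.2.1 + D.s * c.2.2.1,
     - D.p * c.1.2.1 - D.q * c.2.1 + D.s * c.2.2.2, - D.p * c.1.2.2 - D.q * c.2.2.1 - D.r * c.2.2.2))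
  map_add' x y := by ext <;> simp <;> ring
  map_smul' t x := by ext <;> simp <;> ring

lemma mT_apply (a b c a' b' c' : R) : D.mT ((a, b, c), (a', b', c')) =
   ((D.e4 * c - D.e3 * a', D.e2 * b - D.e1 * b', a, c'),
    (D.q * a + D.r * b + D.s * c, - D.p * a + D.r * a' + D.s * b',
     - D.p * b - D.q * a' + D.s * c', - D.p * c - D.q * b' - D.r * c')) := rfl

lemma Good.mDT (hD : D.Good) : Function.Exact D.mT D.mD := by
  rintro ⟨⟨x1, x2, x3, x4⟩, ⟨k1, k2, k3, k4⟩⟩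
  constructor
  · intro h
    rw [mD_apply, Prod.mk_eq_zero] at h
    dsimp only at h
    obtain ⟨h1, h2⟩ := h
    obtain ⟨cpq, cpr, cps, cqr, cqs, crs, rfl, rfl, rfl, rfl⟩ := hD.K1 h2
    have h3 : D.d1 (x1 - (D.e4 * cps - D.e3 * cqr), x2 - (D.e2 * cpr - D.e1 * cqs), x3 - cpq,
        x4 - crs) = 0 := by
      rw [d1_apply]
      unfold A B F G at *
      linear_combination h1
    obtain ⟨⟨a, b, f, g⟩, hκ⟩ := (hD.ex12 _).mp h3
    rw [d2_apply] at hκ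
    simp only [Prod.mk.injEq] at hκ
    obtain ⟨g1, g2, g3, g4⟩ := hκ
    refine ⟨((cpq - D.r * a - D.s * b, cpr + D.q * a - D.s * f, cps + D.q * b + D.r * f),
      (cqr - D.p * a - D.s * g, cqs - D.p * b + D.r * g, crs - D.p * f - D.q * g)), ?_⟩
    rw [mT_apply]
    ext
    · dsimp only; linear_combination g1
    · dsimp only; linear_combination g2
    · dsimp only; linear_combination g3
    · dsimp only; linear_combination g4
    all_goals dsimp only; ring
  · rintro ⟨⟨⟨a, b, c⟩, ⟨a', b', c'⟩⟩, hx⟩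
    rw [← hx, mT_apply, mD_apply]
    unfold A B F G
    rw [Prod.mk_eq_zero]
    constructor <;> ring

lemma Good.mTinj (hD : D.Good) : Function.Injective D.mT := by
  rw [injective_iff_map_eq_zero]
  rintro ⟨⟨a, b, c⟩, ⟨a', b', c'⟩⟩ h
  rw [mT_apply] at h
  simp only [Prod.mk_eq_zero] at h
  obtain ⟨⟨h1, h2, rfl, rfl⟩, h5, h6, h7, h8⟩ := h
  obtain ⟨t, rfl, ht⟩ := hD.rs b (-c) (by linear_combination h5)
  obtain ⟨u, rfl, hu⟩ := hD.rs a' (-b') (by linear_combination h6)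
  have hc : c = - (t * D.r) := by linear_combination -ht
  have hb : b' = - (u * D.r) := by linear_combination -hu
  have h9 : t * D.p = (-u) * D.q := by
    apply mul_right_cancel₀ hD.s0
    linear_combination -h7
  obtain ⟨w, rfl, hw⟩ := hD.pq _ _ h9
  have hu' : u = - (w * D.p) := by linear_combination -hw
  subst hu' hc hb
  have h10 : w * D.B = 0 := by unfold B; linear_combination h1
  have hw0 := (mul_eq_zero.mp h10).resolve_right hD.B0
  subst hw0
  simp

/-- the S2-ification -/
abbrev Apr (D : Dat R) : Type := (R × R) ⧸ LinearMap.range D.mD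

lemma Good.mem_range (hD : D.Good) {ρ : R} : (ρ, (0 : R)) ∈ LinearMap.range D.mD ↔ ρ ∈ D.I := by
  constructor
  · rintro ⟨⟨⟨x1, x2, x3, x4⟩, ⟨k1, k2, k3, k4⟩⟩, h⟩
    rw [mD_apply, Prod.mk.injEq] at h
    dsimp only at h
    obtain ⟨h1, h2⟩ := h
    obtain ⟨cpq, cpr, cps, cqr, cqs, crs, rfl, rfl, rfl, rfl⟩ := hD.K1 h2
    rw [hD.memI]
    refine ⟨x1 - (D.e4 * cps - D.e3 * cqr), x2 - (D.e2 * cpr - D.e1 * cqs), x3 - cpq,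
        x4 - crs, ?_⟩
    unfold A B F G at *
    linear_combination -h1
  · intro h
    obtain ⟨a, b, f, g, rfl⟩ := (hD.memI ρ).mp h
    refine ⟨((a, b, f, g), 0), ?_⟩
    rw [mD_apply]
    simp

variable (D) in
lemma iota_aux (hD : D.Good) : D.I ≤ LinearMap.ker ((LinearMap.range D.mD).mkQ ∘ₗ LinearMap.inl R R R) := by
  intro ρ h
  rw [LinearMap.mem_ker, LinearMap.comp_apply, Submodule.mkQ_apply, Submodule.Quotient.mk_eq_zero]
  exact hD.mem_range.mpr h

def iota (hD : D.Good) : (R ⧸ D.I) →ₗ[R] Apr D :=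
  Submodule.liftQ D.I ((LinearMap.range D.mD).mkQ ∘ₗ LinearMap.inl R R R) (iota_aux D hD)

lemma iota_inj (hD : D.Good) : Function.Injective (iota hD) := by
  rw [injective_iff_map_eq_zero]
  intro x hx
  obtain ⟨ρ, rfl⟩ := Submodule.Quotient.mk_surjective _ x
  rw [Submodule.Quotient.mk_eq_zero]
  apply hD.mem_range.mp
  exact (Submodule.Quotient.mk_eq_zero _).mp hx

lemma piN_aux (hD : D.Good) : LinearMap.range D.mD ≤
    LinearMap.ker ((Submodule.mkQ D.J) ∘ₗ LinearMap.snd R R R) := by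
  rintro _ ⟨⟨⟨x1, x2, x3, x4⟩, ⟨k1, k2, k3, k4⟩⟩, rfl⟩
  rw [LinearMap.mem_ker, LinearMap.comp_apply, Submodule.mkQ_apply, Submodule.Quotient.mk_eq_zero]
  rw [hD.memJ]
  exact ⟨k1, k2, k3, k4, rfl⟩

def piN (hD : D.Good) : Apr D →ₗ[R] (R ⧸ D.J) :=
  Submodule.liftQ _ ((Submodule.mkQ D.J) ∘ₗ LinearMap.snd R R R) (piN_aux hD)

lemma piN_surj (hD : D.Good) : Function.Surjective (piN hD) := by
  intro y
  obtain ⟨ρ, rfl⟩ := Submodule.Quotient.mk_surjective _ y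
  exact ⟨Submodule.Quotient.mk (0, ρ), rfl⟩

lemma ex_iota (hD : D.Good) : Function.Exact (iota hD) (piN hD) := by
  intro y
  obtain ⟨⟨a, b⟩, rfl⟩ := Submodule.Quotient.mk_surjective _ y
  constructor
  · intro h
    have h' : b ∈ D.J := (Submodule.Quotient.mk_eq_zero _).mp h
    obtain ⟨k1, k2, k3, k4, rfl⟩ := (hD.memJ b).mp h'
    refine ⟨Submodule.Quotient.mk (a - (k1 * (D.q * D.e2 * D.e4) + k2 * (D.p * D.e1 * D.e3) +
      k3 * (D.s * D.e2 * D.e3) + k4 * (D.r * D.e1 * D.e4))), ?_⟩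
    refine (Submodule.Quotient.eq _).mpr ?_
    refine ⟨(0, (-k1, -k2, -k3, -k4)), ?_⟩
    rw [mD_apply]
    ext
    · simp; ring
    · simp; ring
  · rintro ⟨x, hx⟩
    obtain ⟨ρ, rfl⟩ := Submodule.Quotient.mk_surjective _ x
    rw [← hx]
    change Submodule.Quotient.mk (0 : R) = _
    simp

lemma killApr_aux (hD : D.Good) {ρ : R} (h1 : ρ ∈ D.I) (h2 : ((0 : R), ρ) ∈ LinearMap.range D.mD)
    (m : Apr D) : ρ • m = 0 := by
  obtain ⟨⟨a, b⟩, rfl⟩ := Submodule.Quotient.mk_surjective _ m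
  rw [← Submodule.Quotient.mk_smul, Submodule.Quotient.mk_eq_zero]
  have : ρ • (a, b) = a • (ρ, (0 : R)) + b • ((0 : R), ρ) := by ext <;> simp [mul_comm]
  rw [this]
  exact Submodule.add_mem _ (Submodule.smul_mem _ _ (hD.mem_range.mpr h1)) (Submodule.smul_mem _ _ h2)

lemma Good.AI (hD : D.Good) : D.A ∈ D.I := (hD.memI _).mpr ⟨1, 0, 0, 0, by ring⟩
lemma Good.BI (hD : D.Good) : D.B ∈ D.I := (hD.memI _).mpr ⟨0, 1, 0, 0, by ring⟩
lemma Good.FI (hD : D.Good) : D.F ∈ D.I := (hD.memI _).mpr ⟨0, 0, 1, 0, by ring⟩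
lemma Good.GI (hD : D.Good) : D.G ∈ D.I := (hD.memI _).mpr ⟨0, 0, 0, 1, by ring⟩

lemma killApr (hD : D.Good) {ρ : R} (h : ρ ∈ D.I) (m : Apr D) : ρ • m = 0 := by
  have hA : D.A • m = 0 := killApr_aux hD hD.AI
    ⟨((0, D.e1 * D.e2, 0, 0), (D.r * D.e1, - D.s * D.e2, 0, 0)), by
      rw [mD_apply]; unfold A B; ext <;> simp <;> ring⟩ m
  have hB : D.B • m = 0 := killApr_aux hD hD.BI
    ⟨((D.e3 * D.e4, 0, 0, 0), (D.s * D.e3, - D.r * D.e4, 0, 0)), by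
      rw [mD_apply]; unfold A B; ext <;> simp <;> ring⟩ m
  have hF : D.F • m = 0 := killApr_aux hD hD.FI
    ⟨((0, 0, 0, 0), (D.p * D.e1 * D.e3, - D.q * D.e2 * D.e4, 0, 0)), by
      rw [mD_apply]; unfold F; ext <;> simp <;> ring⟩ m
  have hG : D.G • m = 0 := killApr_aux hD hD.GI
    ⟨((0, 0, 0, 0), (0, 0, D.r * D.e1 * D.e4, - D.s * D.e2 * D.e3)), by
      rw [mD_apply]; unfold G; ext <;> simp <;> ring⟩ m
  obtain ⟨a, b, f, g, rfl⟩ := (hD.memI ρ).mp h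
  simp only [add_smul, mul_smul, hA, hB, hF, hG, smul_zero, add_zero]

lemma killN (hD : D.Good) : ∀ ρ ∈ [D.p, D.q, D.r, D.s], ∀ m : R ⧸ D.J, ρ • m = 0 := by
  intro ρ h m
  have h' : ρ ∈ D.J := by
    rw [hD.memJ]
    simp only [List.mem_cons, List.not_mem_nil, or_false] at h
    rcases h with rfl | rfl | rfl | rfl
    · exact ⟨1, 0, 0, 0, by ring⟩
    · exact ⟨0, 1, 0, 0, by ring⟩
    · exact ⟨0, 0, 1, 0, by ring⟩
    · exact ⟨0, 0, 0, 1, by ring⟩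
  obtain ⟨a, rfl⟩ := Submodule.Quotient.mk_surjective _ m
  rw [← Submodule.Quotient.mk_smul, Submodule.Quotient.mk_eq_zero, smul_eq_mul]
  exact Ideal.mul_mem_right _ _ h'

section depth
variable {P : Ideal R} [P.IsPrime] {c : ℕ}

lemma DP_J (hD : D.Good) (hself : DP P c R) : DP P (c - 4) (R ⧸ D.J) := by
  have h := DP.quot_list [D.p, D.q, D.r, D.s] R hself hD.wreg
  refine h.congr (Submodule.quotEquivOfEq _ _ ?_)
  ext x
  rw [smul_eq_mul, Ideal.mul_top, hD.memJ]
  change x ∈ Ideal.span {a | a ∈ [D.p, D.q, D.r, D.s]} ↔ _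
  have : {a | a ∈ [D.p, D.q, D.r, D.s]} = ({D.p, D.q, D.r, D.s} : Set R) := by
    ext; simp
  rw [this]
  simp only [Ideal.mem_span_insert, Ideal.mem_span_singleton']
  constructor
  · rintro ⟨a, _, ⟨b, _, ⟨f, _, ⟨g, rfl⟩, rfl⟩, rfl⟩, rfl⟩
    exact ⟨a, b, f, g, by ring⟩
  · rintro ⟨a, b, f, g, rfl⟩
    exact ⟨a, _, ⟨b, _, ⟨f, _, ⟨g, rfl⟩, rfl⟩, rfl⟩, by ring⟩

lemma DP_Apr (hD : D.Good) (hself : DP P c R) : DP P (c - 2) (Apr D) := by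
  have h3 : DP P c (R × R × R) := hself.prod (hself.prod hself)
  have h4 : DP P c (R × R × R × R) := hself.prod h3
  have hW : DP P (c - 1) (LinearMap.range D.mD) := by
    refine DP.right (f := D.mT) (g := D.mD.rangeRestrict) hD.mTinj ?_
      (LinearMap.surjective_rangeRestrict _) (h3.prod h3) ((h4.prod h4).mono (by omega))
    intro y
    rw [← hD.mDT y]
    rw [← Subtype.coe_inj]; rfl
  show DP P (c - 1 - 1) _
  exact DP.right (n := c - 1) (f := (LinearMap.range D.mD).subtype) (g := (LinearMap.range D.mD).mkQ)
    (Submodule.subtype_injective _) (LinearMap.exact_subtype_mkQ _)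
    (Submodule.mkQ_surjective _) hW ((hself.prod hself).mono (by omega))

lemma DP_K (hD : D.Good) (hself : DP P c R) : DP P (c - 2) (Kmod D) := by
  have h4 : DP P c (R × R × R × R) := hself.prod (hself.prod (hself.prod hself))
  have hJ : DP P (c - 3) D.J :=
    DP.left (f := Submodule.subtype D.J) (g := Submodule.mkQ D.J) (Submodule.subtype_injective _)
      (LinearMap.exact_subtype_mkQ _) (Submodule.mkQ_surjective _) (hself.mono (by omega))
      ((DP_J hD hself).mono (by omega))
  have hker : DP P (c - 2) (LinearMap.ker D.t3) := by
    refine DP.left (f := (LinearMap.ker D.t3).subtype) (g := D.t3.codRestrict D.J ?_)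
      (Submodule.subtype_injective _) ?_ ?_ (h4.mono (by omega)) (hJ.mono (by omega))
    · rintro ⟨a, b, f, g⟩
      rw [hD.memJ, t3_apply]
      exact ⟨-g, f, -b, a, by ring⟩
    · intro y
      rw [← Subtype.coe_inj]
      simp
    · rintro ⟨y, hy⟩
      obtain ⟨a, b, f, g, rfl⟩ := (hD.memJ y).mp hy
      refine ⟨(g, -f, b, -a), ?_⟩
      rw [← Subtype.coe_inj]
      simp only [LinearMap.codRestrict_apply, t3_apply]
      ring
  have hB : DP P (c - 1) (LinearMap.range D.t2) := by
    refine DP.right (f := D.t1) (g := D.t2.rangeRestrict) hD.tinj1 ?_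
      (LinearMap.surjective_rangeRestrict _) hself (h4.mono (by omega))
    intro y
    rw [← hD.tex12 y]
    rw [← Subtype.coe_inj]; rfl
  have hle : LinearMap.range D.t2 ≤ LinearMap.ker D.t3 := by
    rintro _ ⟨x, rfl⟩; exact t23 x
  show DP P (c - 1 - 1) _
  refine DP.right (n := c - 1) (f := Submodule.inclusion hle) (g := Submodule.mkQ _)
    (Submodule.inclusion_injective hle) ?_ (Submodule.mkQ_surjective _) hB (hker.mono (by omega))
  intro y
  rw [Submodule.mkQ_apply, Submodule.Quotient.mk_eq_zero, Submodule.mem_comap]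
  constructor
  · intro h
    exact ⟨⟨_, h⟩, rfl⟩
  · rintro ⟨z, rfl⟩
    exact z.2

lemma wregAB (hD : D.Good) : RingTheory.Sequence.IsWeaklyRegular R [D.A, D.B] := by
  rw [RingTheory.Sequence.isWeaklyRegular_cons_iff, RingTheory.Sequence.isWeaklyRegular_singleton_iff]
  refine ⟨fun a b h => mul_left_cancel₀ hD.A0 h, ?_⟩
  rw [isSMulRegular_iff_right_eq_zero_of_smul]
  intro y hy
  obtain ⟨x, rfl⟩ := Submodule.Quotient.mk_surjective _ y
  rw [← Submodule.Quotient.mk_smul, Submodule.Quotient.mk_eq_zero,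
    Submodule.mem_smul_pointwise_iff_exists] at hy
  obtain ⟨z, -, hz⟩ := hy
  simp only [smul_eq_mul] at hz
  obtain ⟨t, ht1, ht2⟩ := hD.hAB z (-x) (by linear_combination hz)
  rw [Submodule.Quotient.mk_eq_zero, Submodule.mem_smul_pointwise_iff_exists]
  exact ⟨t, trivial, by simp only [smul_eq_mul]; linear_combination ht2⟩

end depth
end Dat
end Pf

namespace Pf

lemma homology_equiv {R : Type} [CommRing R] (S : ShortComplex (ModuleCat.{0} R))
    {M1 M2 M3 : Type} [AddCommGroup M1] [Module R M1] [AddCommGroup M2] [Module R M2]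
    [AddCommGroup M3] [Module R M3] (f' : M1 →ₗ[R] M2) (g' : M2 →ₗ[R] M3)
    (e1 : S.X₁ ≃ₗ[R] M1) (e2 : S.X₂ ≃ₗ[R] M2) (e3 : S.X₃ ≃ₗ[R] M3)
    (hf : ∀ x, e2 (S.f.hom x) = f' (e1 x)) (hg : ∀ x, e3 (S.g.hom x) = g' (e2 x)) :
    Nonempty (S.homology ≃ₗ[R] (LinearMap.ker g' ⧸
      (LinearMap.range f').comap (LinearMap.ker g').subtype)) := by
  let ek : LinearMap.ker S.g.hom ≃ₗ[R] LinearMap.ker g' :=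
    e2.ofSubmodules _ _ (by
      ext y
      rw [Submodule.mem_map]
      constructor
      · rintro ⟨x, hx, rfl⟩
        change S.g.hom x = 0 at hx
        change g' (e2 x) = 0
        rw [← hg, hx, map_zero]
      · intro hy
        refine ⟨e2.symm y, ?_, by simp⟩
        change S.g.hom (e2.symm y) = 0
        apply e3.injective
        rw [hg, map_zero, LinearEquiv.apply_symm_apply]
        exact hy)
  suffices h : Nonempty ((LinearMap.ker S.g.hom ⧸ LinearMap.range S.moduleCatToCycles) ≃ₗ[R]
      (LinearMap.ker g' ⧸ (LinearMap.range f').comap (LinearMap.ker g').subtype)) from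
    ⟨LinearEquiv.trans (M₂ := (LinearMap.ker S.g.hom ⧸ LinearMap.range S.moduleCatToCycles))
      (S.moduleCatHomologyIso.toLinearEquiv) h.some⟩
  refine ⟨Submodule.Quotient.equiv (LinearMap.range S.moduleCatToCycles) _ ek ?_⟩
  ext y
  rw [Submodule.mem_map, Submodule.mem_comap]
  constructor
  · rintro ⟨_, ⟨x, rfl⟩, rfl⟩
    exact ⟨e1 x, (hf x).symm⟩
  · rintro ⟨x, hx⟩
    refine ⟨_, ⟨e1.symm x, rfl⟩, ?_⟩
    apply Subtype.ext
    change e2 (S.f.hom (e1.symm x)) = _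
    rw [hf, LinearEquiv.apply_symm_apply, hx]
    rfl

namespace Dat
variable {R : Type} [CommRing R] (D : Dat R)

def cX : ℕ → ModuleCat.{0} R
  | 0 => ModuleCat.of R R
  | 1 => ModuleCat.of R (R × R × R × R)
  | 2 => ModuleCat.of R (R × R × R × R)
  | 3 => ModuleCat.of R R
  | _ + 4 => ModuleCat.of R PUnit

def cd : ∀ n, cX (R := R) (n + 1) ⟶ cX n
  | 0 => ModuleCat.ofHom D.d1
  | 1 => ModuleCat.ofHom D.d2
  | 2 => ModuleCat.ofHom D.d3
  | _ + 3 => 0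

variable {D} [IsDomain R]

lemma Good.csq (hD : D.Good) : ∀ n, D.cd (n + 1) ≫ D.cd n = 0
  | 0 => by
    exact ModuleCat.hom_ext (LinearMap.ext fun x => (hD.ex12 _).mpr ⟨x, rfl⟩)
  | 1 => by
    exact ModuleCat.hom_ext (LinearMap.ext fun x => (hD.ex23 _).mpr ⟨x, rfl⟩)
  | 2 => Limits.zero_comp
  | n + 3 => Limits.zero_comp

def cplx (hD : D.Good) : ChainComplex (ModuleCat.{0} R) ℕ := ChainComplex.of cX D.cd hD.csq

lemma Good.cd_eq (hD : D.Good) (n : ℕ) : (cplx hD).d (n+1) n = D.cd n := ChainComplex.of_d ..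

lemma Good.exactAt (hD : D.Good) (n : ℕ) : (cplx hD).ExactAt (n + 1) := by
  rw [HomologicalComplex.exactAt_iff' _ (n + 1 + 1) (n + 1) n (by simp) (by simp)]
  rw [ShortComplex.moduleCat_exact_iff]
  simp only [HomologicalComplex.sc', HomologicalComplex.shortComplexFunctor', hD.cd_eq]
  match n with
  | 0 => exact fun x hx => (hD.ex12 x).mp hx
  | 1 => exact fun x hx => (hD.ex23 x).mp hx
  | 2 => exact fun x hx => ⟨0, (map_zero (D.cd 3).hom).trans
      (hD.inj3 ((map_zero D.d3).trans (Eq.symm hx)))⟩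
  | n + 3 => exact fun x hx => ⟨0, Subsingleton.elim (α := PUnit) _ _⟩

lemma cproj : ∀ n, Projective (cX (R := R) n)
  | 0 => ModuleCat.projective_of_free (Module.Free.chooseBasis R R)
  | 1 => ModuleCat.projective_of_free (Module.Free.chooseBasis R (R × R × R × R))
  | 2 => ModuleCat.projective_of_free (Module.Free.chooseBasis R (R × R × R × R))
  | 3 => ModuleCat.projective_of_free (Module.Free.chooseBasis R R)
  | n + 4 => ModuleCat.projective_of_free (Module.Free.chooseBasis R PUnit)

def cpi (hD : D.Good) : (cplx hD).X 0 ⟶ ModuleCat.of R (R ⧸ D.I) :=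
  ModuleCat.ofHom (Submodule.mkQ D.I)

lemma Good.cpi_zero (hD : D.Good) : (cplx hD).d 1 0 ≫ cpi hD = 0 := by
  rw [hD.cd_eq]
  exact ModuleCat.hom_ext (LinearMap.ext fun x => (Submodule.Quotient.mk_eq_zero D.I).mpr
    ((hD.memI _).mpr ⟨_, _, _, _, d1_apply x⟩))

def cres (hD : D.Good) : ProjectiveResolution (ModuleCat.of R (R ⧸ D.I)) where
  complex := cplx hD
  projective := cproj
  π := (ChainComplex.toSingle₀Equiv _ _).symm ⟨cpi hD, hD.cpi_zero⟩
  quasiIso := ⟨fun n => by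
    cases n
    · rw [ChainComplex.quasiIsoAt₀_iff, ShortComplex.quasiIso_iff_of_zeros' _ rfl rfl rfl]
      constructor
      · rw [ShortComplex.moduleCat_exact_iff]
        intro x hx
        have hx' : (x : R) ∈ D.I := (Submodule.Quotient.mk_eq_zero D.I).mp hx
        obtain ⟨a, b, f, g, h⟩ := (hD.memI _).mp hx'
        refine ⟨((a, b, f, g) : R × R × R × R), ?_⟩
        have := hD.cd_eq 0
        have h2 : ((cplx hD).d 1 0).hom ((a, b, f, g) : R × R × R × R) = x := by
          rw [this]
          exact h.symm
        exact h2
      · rw [ModuleCat.epi_iff_surjective]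
        exact Submodule.mkQ_surjective D.I
    · rw [quasiIsoAt_iff_exactAt']
      · apply hD.exactAt
      · apply ChainComplex.exactAt_succ_single_obj⟩

end Dat
end Pf

namespace Pf
namespace Dat
variable {R : Type} [CommRing R] {D : Dat R} [IsDomain R]

/-- Hom out of `R⁴` -/
def hom4 : (ModuleCat.of R (R × R × R × R) ⟶ ModuleCat.of R R) ≃ₗ[R] (R × R × R × R) where
  toFun φ := (φ.hom (1, 0, 0, 0), φ.hom (0, 1, 0, 0), φ.hom (0, 0, 1, 0), φ.hom (0, 0, 0, 1))
  invFun x := ModuleCat.ofHom (row x.1 x.2.1 x.2.2.1 x.2.2.2)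
  map_add' φ ψ := rfl
  map_smul' t φ := rfl
  left_inv φ := by
    apply ModuleCat.hom_ext
    apply LinearMap.ext
    rintro ⟨a, b, c, d⟩
    have h : ((a, b, c, d) : R × R × R × R) = a • (1, 0, 0, 0) + b • (0, 1, 0, 0) +
      c • (0, 0, 1, 0) + d • (0, 0, 0, 1) := by ext <;> simp
    have h2 := congrArg φ.hom h
    rw [map_add, map_add, map_add, map_smul, map_smul, map_smul, map_smul] at h2
    rw [h2]
    simp [row_apply]
  right_inv x := by
    obtain ⟨a, b, c, d⟩ := x
    simp [row_apply]

def hom1 : (ModuleCat.of R R ⟶ ModuleCat.of R R) ≃ₗ[R] R where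
  toFun φ := φ.hom 1
  invFun x := ModuleCat.ofHom (LinearMap.toSpanSingleton R R x)
  map_add' φ ψ := rfl
  map_smul' t φ := rfl
  left_inv φ := by
    apply ModuleCat.hom_ext
    apply LinearMap.ext
    intro a
    have h : φ.hom a = a • φ.hom 1 := by rw [← map_smul]; simp
    rw [h]; rfl
  right_inv x := by simp

def hom0 : (ModuleCat.of R PUnit.{1} ⟶ ModuleCat.of R R) ≃ₗ[R] PUnit.{1} where
  toFun φ := PUnit.unit
  invFun x := 0
  map_add' φ ψ := rfl
  map_smul' t φ := rfl
  left_inv φ := by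
    apply ModuleCat.hom_ext
    apply LinearMap.ext
    intro a
    exact (map_zero φ.hom).symm
  right_inv x := rfl

def yo (hD : D.Good) := ((cplx hD).linearYonedaObj R (ModuleCat.of R R))

lemma Good.ext_eq (hD : D.Good) (n : ℕ) : Nonempty (extModule R (n+1) (R ⧸ D.I) R ≃ₗ[R]
    ((yo hD).sc' n (n+1) (n+1+1)).homology) := by
  have e1 := (cres hD).isoExt (R := R) (n+1) (ModuleCat.of R R)
  have e2 : (yo hD).homology (n+1) ≅ ((yo hD).sc' n (n+1) (n+1+1)).homology :=
    ShortComplex.homologyMapIso ((yo hD).isoSc' n (n+1) (n+1+1) (by simp) (by simp))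
  exact ⟨(e1 ≪≫ e2).toLinearEquiv⟩

lemma Good.yo_d (hD : D.Good) (n : ℕ) (φ : cX (R := R) n ⟶ ModuleCat.of R R) :
    (((yo hD).d n (n+1)).hom φ : cX (R := R) (n+1) ⟶ ModuleCat.of R R) = D.cd n ≫ φ := by
  rw [← hD.cd_eq]; rfl

lemma comp1 (a b c d : R) (φ : ModuleCat.of R (R × R × R × R) ⟶ ModuleCat.of R R) :
    hom1 (ModuleCat.ofHom (col a b c d) ≫ φ) = row a b c d (hom4 φ) := by
  obtain ⟨x, rfl⟩ := hom4.symm.surjective φ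
  simp [hom1, hom4, row_apply, col_apply, mul_comm]

lemma comp2 (φ : ModuleCat.of R (R × R × R × R) ⟶ ModuleCat.of R R) :
    hom4 (ModuleCat.ofHom D.d2 ≫ φ) = D.t2 (hom4 φ) := by
  obtain ⟨x, rfl⟩ := hom4.symm.surjective φ
  simp [hom4, row_apply, d2_apply, t2_apply, mul_comm]

lemma Good.ext2 (hD : D.Good) : Nonempty (extModule R 2 (R ⧸ D.I) R ≃ₗ[R] Kmod D) := by
  refine ⟨(hD.ext_eq 1).some.trans (homology_equiv _ D.t2 D.t3 hom4 hom4 hom1 ?_ ?_).some⟩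
  · intro φ
    refine (congrArg hom4 (hD.yo_d 1 φ)).trans (comp2 _)
  · intro φ
    exact (congrArg hom1 (hD.yo_d 2 φ)).trans (comp1 _ _ _ _ _)

lemma Good.ext3 (hD : D.Good) : Nonempty (extModule R 3 (R ⧸ D.I) R ≃ₗ[R] (R ⧸ D.J)) := by
  have e := (homology_equiv ((yo hD).sc' 2 3 4) D.t3 (0 : R →ₗ[R] PUnit.{1}) hom4 hom1 hom0
    (fun φ => (congrArg hom1 (hD.yo_d 2 φ)).trans (comp1 _ _ _ _ _))
    (fun φ => rfl)).some
  suffices h : Nonempty ((LinearMap.ker (0 : R →ₗ[R] PUnit.{1}) ⧸ (LinearMap.range D.t3).comap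
      (LinearMap.ker (0 : R →ₗ[R] PUnit.{1})).subtype) ≃ₗ[R] (R ⧸ D.J)) from
    ⟨((hD.ext_eq 2).some.trans e).trans h.some⟩
  constructor
  refine Submodule.Quotient.equiv _ _ ((LinearEquiv.ofEq _ _ LinearMap.ker_zero).trans Submodule.topEquiv) ?_
  ext y
  constructor
  · rintro ⟨x, ⟨z, hz⟩, rfl⟩
    rw [hD.memJ]
    refine ⟨-z.2.2.2, z.2.2.1, -z.2.1, z.1, ?_⟩
    refine hz.symm.trans ?_
    rw [t3_apply]; ring
  · intro hy
    obtain ⟨a, b, f, g, rfl⟩ := (hD.memJ y).mp hy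
    have h3 : D.t3 (g, -f, b, -a) = a * D.p + b * D.q + f * D.r + g * D.s := by
      rw [t3_apply]; dsimp only; ring
    exact ⟨⟨_, rfl⟩, ⟨(g, -f, b, -a), h3⟩, rfl⟩
end Dat
end Pf

namespace Pf
namespace Dat
variable {R : Type} [CommRing R] {D : Dat R} [IsDomain R] [IsRegularRing R]

lemma locdim (P : Ideal R) [P.IsPrime] :
    ∃ c : ℕ, ringKrullDim (Localization.AtPrime P) = c := by
  have h1 : ringKrullDim (Localization.AtPrime P) ≠ ⊥ := ringKrullDim_ne_bot
  have h2 : ringKrullDim (Localization.AtPrime P) ≠ ⊤ := ringKrullDim_ne_top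
  generalize ringKrullDim (Localization.AtPrime P) = x at h1 h2
  induction x using WithBot.recBotCoe with
  | bot => exact absurd rfl h1
  | coe x =>
    induction x using ENat.recTopCoe with
    | top => exact absurd rfl h2
    | coe n => exact ⟨n, rfl⟩

lemma killAB (hD : D.Good) {M : Type} [AddCommGroup M] [Module R M]
    (h : ∀ r ∈ D.I, ∀ m : M, r • m = 0) : ∀ r ∈ [D.A, D.B], ∀ m : M, r • m = 0 := by
  intro r hr m
  simp only [List.mem_cons, List.not_mem_nil, or_false] at hr
  rcases hr with rfl | rfl
  · exact h _ hD.AI m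
  · exact h _ hD.BI m

instance : Module.Finite R (Apr D) := by unfold Apr; infer_instance
instance : Module.Finite R (Kmod D) := by unfold Kmod; infer_instance

lemma cm_Apr (hD : D.Good) : IsCMModAll R (Apr D) := by
  intro P hP
  obtain ⟨c, hc⟩ := locdim P
  exact cm_crit P hc (wregAB hD) (killAB hD fun r hr m => killApr hD hr m)
    (DP_Apr hD (DP_self hc))

lemma cm_J (hD : D.Good) : IsCMModAll R (R ⧸ D.J) := by
  intro P hP
  obtain ⟨c, hc⟩ := locdim P
  exact cm_crit P hc hD.wreg (killN hD) (DP_J hD (DP_self hc))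

lemma cm_K (hD : D.Good) {M : Type} [AddCommGroup M] [Module R M] (e : M ≃ₗ[R] Kmod D) :
    IsCMModAll R M := by
  intro P hP
  obtain ⟨c, hc⟩ := locdim P
  have : Module.Finite R M := Module.Finite.equiv e.symm
  refine cm_crit P hc (wregAB hD) (killAB hD fun r hr m => ?_)
    ((DP_K hD (DP_self hc)).congr e.symm)
  apply e.injective
  rw [map_smul, map_zero, hD.killK hr]

lemma dim_K (hD : D.Good) {M : Type} [AddCommGroup M] [Module R M] (e : M ≃ₗ[R] Kmod D) :
    moduleDim R M = ringKrullDim (R ⧸ D.I) := by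
  change Module.supportDim R M = _
  have : Module.Finite R M := Module.Finite.equiv e.symm
  rw [Module.supportDim_eq_ringKrullDim_quotient_annihilator]
  have : Module.annihilator R M = D.I := by
    ext ρ
    rw [Module.mem_annihilator]
    constructor
    · intro h
      apply hD.annK
      intro m
      obtain ⟨x, rfl⟩ := e.surjective m
      rw [← map_smul, h, map_zero]
    · intro h m
      apply e.injective
      rw [map_smul, map_zero, hD.killK h]
  rw [this]

lemma dim_cok (hD : D.Good) : moduleDim R (Apr D ⧸ LinearMap.range (iota hD)) ≤
    ringKrullDim (R ⧸ D.J) := by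
  apply dim_le_of_kill
  intro ρ h m
  obtain ⟨y, rfl⟩ := Submodule.Quotient.mk_surjective _ m
  rw [← Submodule.Quotient.mk_smul, Submodule.Quotient.mk_eq_zero]
  refine (ex_iota hD _).mp ?_
  rw [map_smul]
  obtain ⟨x, hx⟩ := Submodule.Quotient.mk_surjective _ (piN hD y)
  rw [← hx, ← Submodule.Quotient.mk_smul, Submodule.Quotient.mk_eq_zero]
  exact D.J.mul_mem_right _ h

lemma noncm_locus (hD : D.Good) (P : Ideal R) (hP : P.IsPrime) :
    (⟨P, hP⟩ : PrimeSpectrum R) ∈ Module.support R (R ⧸ D.J) ↔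
      ¬ IsCM (Localization.AtPrime P) (LocalizedModule P.primeCompl (R ⧸ D.I)) := by
  obtain ⟨c, hc⟩ := locdim P
  have hs : (⟨P, hP⟩ : PrimeSpectrum R) ∈ Module.support R (R ⧸ D.J) ↔
    ¬ Subsingleton (LocalizedModule P.primeCompl (R ⧸ D.J)) := by
    rw [Module.mem_support_iff, not_subsingleton_iff_nontrivial]
  rw [hs]
  constructor
  · intro h
    exact noncm P hc D.I (fun r hr m => killApr hD hr m) (iota_inj hD) (ex_iota hD) (piN_surj hD)
      (DP_Apr hD (DP_self hc)) hD.wreg rfl (killN hD) h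
  · intro h hsub
    apply h
    refine cm_crit P hc (wregAB hD) (killAB hD fun r hr m => ?_)
      (DP.left (iota_inj hD) (ex_iota hD) (piN_surj hD) (DP_Apr hD (DP_self hc))
        (DP.of_subsingleton_loc _))
    obtain ⟨x, rfl⟩ := Submodule.Quotient.mk_surjective _ m
    rw [← Submodule.Quotient.mk_smul, Submodule.Quotient.mk_eq_zero]
    exact D.I.mul_mem_right _ hr

theorem assemble (hD : D.Good) (d : ℕ) (hdim : ringKrullDim (R ⧸ D.I) = d)
    (hJ : ringKrullDim (R ⧸ D.J) = ((d - 2 : ℕ) : WithBot ℕ∞)) :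
    (IsCMModAll R ↥(extModule R 2 (R ⧸ D.I) R) ∧
     moduleDim R ↥(extModule R 2 (R ⧸ D.I) R) = (d : WithBot ℕ∞)) ∧
    (∃ (A' : ModuleCat.{0} R) (ι : (R ⧸ D.I) →ₗ[R] ↥A'),
      Function.Injective ι ∧ SerreS2 R ↥A' ∧
      moduleDim R (↥A' ⧸ LinearMap.range ι) ≤ ((d - 2 : ℕ) : WithBot ℕ∞) ∧
      IsCMModAll R ↥A') ∧
    (∃ N : ModuleCat.{0} R, Module.Finite R ↥N ∧ IsCMModAll R ↥N ∧
      moduleDim R ↥N = ((d - 2 : ℕ) : WithBot ℕ∞) ∧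
      ∀ (P : Ideal R) (hP : P.IsPrime),
        ((⟨P, hP⟩ : PrimeSpectrum R) ∈ Module.support R ↥N ↔
          ¬ IsCM (Localization.AtPrime P) (LocalizedModule P.primeCompl (R ⧸ D.I)))) := by
  obtain ⟨e⟩ := hD.ext2
  refine ⟨⟨cm_K hD e, (dim_K hD e).trans hdim⟩,
    ⟨ModuleCat.of R (Apr D), iota hD, iota_inj hD, serre_of_cm (cm_Apr hD),
      (dim_cok hD).trans hJ.le, cm_Apr hD⟩,
    ⟨ModuleCat.of R (R ⧸ D.J), inferInstanceAs (Module.Finite R (R ⧸ D.J)), cm_J hD, ?_,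
      noncm_locus hD⟩⟩
  rw [← hJ]
  exact (Module.supportDim_quotient_eq_ringKrullDim D.J)

end Dat
end Pf

namespace Pf
section lat
variable {K : Type} [Field K] {σ : Type} [Fintype σ]

/-- monomials -/
def mn (K : Type) [Field K] {σ : Type} [Fintype σ] (e : σ → ℕ) : MvPolynomial σ K := ∏ i, X i ^ e i

lemma mn_add (e f : σ → ℕ) : mn K (fun i => e i + f i) = mn K e * mn K f := by
  simp [mn, pow_add, Finset.prod_mul_distrib]

lemma mn_mul (e f g : σ → ℕ) (h : ∀ i, e i + f i = g i) : mn K e * mn K f = mn K g := by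
  rw [← mn_add]; congr 1; funext i; exact h i

lemma mn_zero (e : σ → ℕ) (h : ∀ i, e i = 0) : mn K e = 1 := by simp [mn, h]

abbrev fb (K : Type) [Field K] (u : σ → ℤ) : MvPolynomial σ K := latticeBinomial K u

lemma fb_def (u : σ → ℤ) : fb K u = mn K (fun i => (u i).toNat) - mn K (fun i => (-(u i)).toNat) := rfl

lemma fb_zero : fb K (0 : σ → ℤ) = 0 := by simp [fb_def]

lemma fb_neg (u : σ → ℤ) : fb K (-u) = - fb K u := by simp [fb_def]

lemma path (u v : σ → ℤ) : ∃ C D : σ → ℕ,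
    mn K (fun i => min (u i).toNat (-(v i)).toNat) * fb K (u + v) = mn K C * fb K u + mn K D * fb K v := by
  refine ⟨fun i => min (u i).toNat (-(v i)).toNat + ((u + v) i).toNat - (u i).toNat,
    fun i => min (u i).toNat (-(v i)).toNat + (-((u + v) i)).toNat - (-(v i)).toNat, ?_⟩
  simp only [fb_def, mul_sub, ← mn_add]
  have h1 : (fun i => min (u i).toNat (-(v i)).toNat + ((u + v) i).toNat) = fun i =>
      min (u i).toNat (-(v i)).toNat + ((u + v) i).toNat - (u i).toNat + (u i).toNat := by
    funext i; simp only [Pi.add_apply]; omega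
  have h2 : (fun i => min (u i).toNat (-(v i)).toNat + (-((u + v) i)).toNat) = fun i =>
      min (u i).toNat (-(v i)).toNat + (-((u + v) i)).toNat - (-(v i)).toNat + (-(v i)).toNat := by
    funext i; simp only [Pi.add_apply]; omega
  have h3 : (fun i => min (u i).toNat (-(v i)).toNat + ((u + v) i).toNat - (u i).toNat + (-(u i)).toNat)
     = fun i => min (u i).toNat (-(v i)).toNat + (-((u + v) i)).toNat - (-(v i)).toNat + (v i).toNat := by
    funext i; simp only [Pi.add_apply]; omega
  rw [← h1, ← h2, h3]
  ring

lemma path_mem {J : Ideal (MvPolynomial σ K)} {u v : σ → ℤ} (hu : fb K u ∈ J) (hv : fb K v ∈ J)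
    (h : ∀ i, 0 < u i → 0 ≤ v i) : fb K (u + v) ∈ J := by
  obtain ⟨C, D, hCD⟩ := path (K := K) u v
  rw [mn_zero _ (fun i => by have := h i; omega), one_mul] at hCD
  rw [hCD]
  exact J.add_mem (J.mul_mem_left _ hu) (J.mul_mem_left _ hv)

def E (a b : σ → ℤ) : Prop := (∃ i, 0 < a i ∧ b i < 0) ∧ (∃ i, a i < 0 ∧ 0 < b i)
def Quad (a b : σ → ℤ) : Prop := E a b ∧ E a (-b)

lemma cone1 {J : Ideal (MvPolynomial σ K)} {a : σ → ℤ} (ha : fb K a ∈ J) (m : ℕ) :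
    fb K ((m : ℤ) • a) ∈ J := by
  induction m with
  | zero => simp [fb_zero]
  | succ m ih =>
    have : ((m + 1 : ℕ) : ℤ) • a = (m : ℤ) • a + a := by push_cast; rw [add_smul, one_smul]
    rw [this]
    refine path_mem ih ha (fun i hi => ?_)
    simp only [Pi.smul_apply, smul_eq_mul] at hi
    by_contra hn
    nlinarith [Int.natCast_nonneg m]

lemma cone {J : Ideal (MvPolynomial σ K)} {a b : σ → ℤ} (ha : fb K a ∈ J) (hb : fb K b ∈ J)
    (hE : ¬ E a b) (m n : ℕ) : fb K ((m : ℤ) • a + (n : ℤ) • b) ∈ J := by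
  have hE' : (∀ i, 0 < a i → 0 ≤ b i) ∨ (∀ i, a i < 0 → b i ≤ 0) := by
    by_contra hc
    push Not at hc
    obtain ⟨⟨i, hi⟩, ⟨j, hj⟩⟩ := hc
    exact hE ⟨⟨i, hi⟩, ⟨j, hj⟩⟩
  induction m with
  | zero => simpa using cone1 hb n
  | succ m ih =>
    rcases hE' with h | h
    · have : ((m + 1 : ℕ) : ℤ) • a + (n : ℤ) • b = a + ((m : ℤ) • a + (n : ℤ) • b) := by
        push_cast; rw [add_smul, one_smul]; abel
      rw [this]
      refine path_mem ha ih (fun i hi => ?_)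
      simp only [Pi.add_apply, Pi.smul_apply, smul_eq_mul]
      have := h i hi
      positivity
    · have : ((m + 1 : ℕ) : ℤ) • a + (n : ℤ) • b = ((m : ℤ) • a + (n : ℤ) • b) + a := by
        push_cast; rw [add_smul, one_smul]; abel
      rw [this]
      refine path_mem ih ha (fun i hi => ?_)
      simp only [Pi.add_apply, Pi.smul_apply, smul_eq_mul] at hi
      by_contra hn
      have := h i (by omega)
      nlinarith [Int.natCast_nonneg m, Int.natCast_nonneg n]

/-- `a, b` is a basis of `L`. -/
structure Bas (L : AddSubgroup (σ → ℤ)) (a b : σ → ℤ) : Prop where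
  mem : ∀ z, z ∈ L ↔ ∃ m n : ℤ, z = m • a + n • b
  ind : ∀ m n : ℤ, m • a + n • b = 0 → m = 0 ∧ n = 0

variable {L : AddSubgroup (σ → ℤ)} {a b : σ → ℤ}

lemma Bas.swap (h : Bas L a b) : Bas L b a :=
  ⟨fun z => (h.mem z).trans ⟨fun ⟨m, n, e⟩ => ⟨n, m, by rw [e, add_comm]⟩,
    fun ⟨m, n, e⟩ => ⟨n, m, by rw [e, add_comm]⟩⟩,
   fun m n e => (h.ind n m (by rw [← e, add_comm])).symm⟩

lemma Bas.neg (h : Bas L a b) : Bas L a (-b) :=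
  ⟨fun z => (h.mem z).trans ⟨fun ⟨m, n, e⟩ => ⟨m, -n, by rw [e]; simp⟩,
    fun ⟨m, n, e⟩ => ⟨m, -n, by rw [e]; simp⟩⟩,
   fun m n e => by
    have := h.ind m (-n) (by rw [← e]; simp)
    omega⟩

lemma Bas.add (h : Bas L a b) : Bas L a (a + b) :=
  ⟨fun z => (h.mem z).trans ⟨fun ⟨m, n, e⟩ => ⟨m - n, n, by rw [e]; module⟩,
    fun ⟨m, n, e⟩ => ⟨m + n, n, by rw [e]; module⟩⟩,
   fun m n e => by
    have := h.ind (m + n) n (by rw [← e]; module)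
    omega⟩

lemma Bas.add' (h : Bas L a b) : Bas L (a + b) b := by
  have := h.swap.add.swap
  rwa [add_comm] at this

lemma E.swap (h : E a b) : E b a := by
  obtain ⟨⟨i, hi⟩, ⟨j, hj⟩⟩ := h
  exact ⟨⟨j, hj.2, hj.1⟩, ⟨i, hi.2, hi.1⟩⟩

lemma E.neg (h : E a b) : E (-a) (-b) := by
  obtain ⟨⟨i, hi⟩, ⟨j, hj⟩⟩ := h
  exact ⟨⟨j, by simp only [Pi.neg_apply]; omega, by simp only [Pi.neg_apply]; omega⟩,
    ⟨i, by simp only [Pi.neg_apply]; omega, by simp only [Pi.neg_apply]; omega⟩⟩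

lemma Quad.neg (h : Quad a b) : Quad a (-b) := ⟨h.2, by rw [neg_neg]; exact h.1⟩
lemma Quad.swap (h : Quad a b) : Quad b a :=
  ⟨h.1.swap, by have := h.2.swap.neg; rwa [neg_neg] at this⟩

lemma E.of_add (h : E a (a + b)) : E a b := by
  obtain ⟨⟨i, hi⟩, ⟨j, hj⟩⟩ := h
  simp only [Pi.add_apply] at hi hj
  exact ⟨⟨i, by omega, by omega⟩, ⟨j, by omega, by omega⟩⟩

lemma E.add_neg (h : E a (-b)) : E a (-(a + b)) := by
  obtain ⟨⟨i, hi⟩, ⟨j, hj⟩⟩ := h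
  simp only [Pi.neg_apply] at hi hj
  refine ⟨⟨i, ?_⟩, ⟨j, ?_⟩⟩ <;> simp only [Pi.neg_apply, Pi.add_apply] <;> omega

lemma Quad.add (h : Quad a b) (h2 : E a (a + b)) : Quad a (a + b) := ⟨h2, h.2.add_neg⟩

/-- termwise measure -/
def gm (s t : ℤ) : ℕ := if (0 < s ∧ t < 0) ∨ (s < 0 ∧ 0 < t) then s.natAbs + t.natAbs else 0
def mu (a b : σ → ℤ) : ℕ := ∑ i, gm (a i) (b i)

lemma mu_add (h : E a (a + b)) : mu a (a + b) < mu a b := by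
  obtain ⟨⟨i, hi⟩, -⟩ := h
  refine Finset.sum_lt_sum (fun j _ => ?_) ⟨i, Finset.mem_univ _, ?_⟩
  · simp only [gm, Pi.add_apply]; split_ifs <;> omega
  · simp only [gm, Pi.add_apply] at hi ⊢; split_ifs <;> omega

lemma mu_add' (h : E (a + b) b) : mu (a + b) b < mu a b := by
  obtain ⟨⟨i, hi⟩, -⟩ := h
  refine Finset.sum_lt_sum (fun j _ => ?_) ⟨i, Finset.mem_univ _, ?_⟩
  · simp only [gm, Pi.add_apply]; split_ifs <;> omega
  · simp only [gm, Pi.add_apply] at hi ⊢; split_ifs <;> omega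

/-- quadrant covered by two cones -/
lemma quadrant {J : Ideal (MvPolynomial σ K)} (ha : fb K a ∈ J) (hb : fb K b ∈ J)
    (hab : fb K (a + b) ∈ J) (h1 : ¬ E a (a + b)) (h2 : ¬ E (a + b) b) (m n : ℕ) :
    fb K ((m : ℤ) • a + (n : ℤ) • b) ∈ J := by
  rcases le_total n m with h | h
  · obtain ⟨k, rfl⟩ := Nat.exists_eq_add_of_le h
    have := cone ha hab h1 k n
    convert this using 2
    push_cast; module
  · obtain ⟨k, rfl⟩ := Nat.exists_eq_add_of_le h
    have := cone hab hb h2 m k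
    convert this using 2
    push_cast; module

lemma neg_mem {J : Ideal (MvPolynomial σ K)} {u : σ → ℤ} (h : fb K (-u) ∈ J) : fb K u ∈ J := by
  rw [fb_neg] at h; simpa using h

lemma lattice_le {J : Ideal (MvPolynomial σ K)} (hB : Bas L a b)
    (h1 : ∀ m n : ℕ, fb K ((m : ℤ) • a + (n : ℤ) • b) ∈ J)
    (h2 : ∀ m n : ℕ, fb K ((m : ℤ) • a + (n : ℤ) • (-b)) ∈ J) :
    latticeIdeal K (L : Set (σ → ℤ)) ≤ J := by
  rw [latticeIdeal, Ideal.span_le]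
  rintro _ ⟨z, hz, rfl⟩
  obtain ⟨m, n, rfl⟩ := (hB.mem z).mp hz
  obtain ⟨m, rfl | rfl⟩ := m.eq_nat_or_neg <;> obtain ⟨n, rfl | rfl⟩ := n.eq_nat_or_neg
  · exact h1 m n
  · have := h2 m n
    rwa [smul_neg, ← neg_smul] at this
  · refine neg_mem ?_
    have := h2 m n
    convert this using 2
    module
  · refine neg_mem ?_
    have := h1 m n
    convert this using 2
    module

lemma fb_mem {z : σ → ℤ} (hz : z ∈ L) : fb K z ∈ latticeIdeal K (L : Set (σ → ℤ)) :=
  Ideal.subset_span ⟨z, hz, rfl⟩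

lemma Bas.a_mem (hB : Bas L a b) : a ∈ L := (hB.mem a).mpr ⟨1, 0, by simp⟩
lemma Bas.b_mem (hB : Bas L a b) : b ∈ L := hB.swap.a_mem

lemma three (hB : Bas L a b) (h0 : ¬ E a (-b)) (h1 : ¬ E a (a + b)) (h2 : ¬ E (a + b) b) :
    ∃ f : Fin 3 → MvPolynomial σ K, latticeIdeal K (L : Set (σ → ℤ)) = Ideal.span (Set.range f) := by
  refine ⟨![fb K a, fb K b, fb K (a + b)], le_antisymm ?_ ?_⟩
  · have ha : fb K a ∈ Ideal.span (Set.range ![fb K a, fb K b, fb K (a + b)]) :=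
      Ideal.subset_span ⟨0, rfl⟩
    have hb : fb K b ∈ Ideal.span (Set.range ![fb K a, fb K b, fb K (a + b)]) :=
      Ideal.subset_span ⟨1, rfl⟩
    have hab : fb K (a + b) ∈ Ideal.span (Set.range ![fb K a, fb K b, fb K (a + b)]) :=
      Ideal.subset_span ⟨2, rfl⟩
    exact lattice_le hB (quadrant ha hb hab h1 h2)
      (cone ha (neg_mem (by rwa [neg_neg])) h0)
  · rw [Ideal.span_le]
    rintro _ ⟨i, rfl⟩
    fin_cases i
    · exact fb_mem hB.a_mem
    · exact fb_mem hB.b_mem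
    · exact fb_mem (L.add_mem hB.a_mem hB.b_mem)

lemma noquad (hq : ∀ a b, Bas L a b → ¬ Quad a b) (N : ℕ) : ∀ a b : σ → ℤ, Bas L a b → ¬ E a (-b) →
    mu a b ≤ N → ∃ f : Fin 3 → MvPolynomial σ K,
      latticeIdeal K (L : Set (σ → ℤ)) = Ideal.span (Set.range f) := by
  induction N with
  | zero =>
    intro a b hB h0 hm
    refine three hB h0 (fun h => ?_) (fun h => ?_)
    · have := mu_add h; omega
    · have := mu_add' h; omega
  | succ N ih =>
    intro a b hB h0 hm
    by_cases h1 : E a (a + b)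
    · refine ih a (a + b) hB.add (fun h => hq _ _ hB.add ⟨h1, h⟩) ?_
      have := mu_add h1; omega
    by_cases h2 : E (a + b) b
    · refine ih (a + b) b hB.add' (fun h => hq _ _ hB.add' ⟨h2, h⟩) ?_
      have := mu_add' h2; omega
    exact three hB h0 h1 h2

lemma exists_quad (hB : Bas L a b) (hmin : ¬ ∃ f : Fin 3 → MvPolynomial σ K,
      latticeIdeal K (L : Set (σ → ℤ)) = Ideal.span (Set.range f)) :
    ∃ a b, Bas L a b ∧ Quad a b := by
  by_contra hc
  push Not at hc
  apply hmin
  by_cases h : E a (-b)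
  · have h' : ¬ E a (- -b) := fun h2 => hc a (-b) hB.neg ⟨h, h2⟩
    exact noquad hc _ a (-b) hB.neg h' le_rfl
  · exact noquad hc _ a b hB h le_rfl

end lat
end Pf

namespace Pf
section lat2
variable {K : Type} [Field K] {σ : Type} [Fintype σ]
variable {L : AddSubgroup (σ → ℤ)} {a b : σ → ℤ}

/-- exponent vector -/
def ex (e : σ → ℕ) : σ →₀ ℕ := Finsupp.equivFunOnFinite.symm e

lemma ex_apply (e : σ → ℕ) (i : σ) : ex e i = e i := rfl

lemma ex_inj {e f : σ → ℕ} (h : ex e = ex f) : e = f := Finsupp.equivFunOnFinite.symm.injective h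

lemma mn_eq (e : σ → ℕ) : mn K e = monomial (ex e) 1 := by
  classical
  rw [MvPolynomial.monomial_eq, map_one, one_mul, Finsupp.prod_fintype _ _ (by simp)]
  rfl

/-- isolation -/
def Iso (L : AddSubgroup (σ → ℤ)) (z : σ → ℤ) : Prop :=
  ∀ y ∈ L, (∀ i, y i ≤ max 0 (z i)) → y = 0 ∨ y = z

lemma iso_a (hB : Bas L a b) (hQ : Quad a b) : Iso L a := by
  intro y hy h
  obtain ⟨m, n, rfl⟩ := (hB.mem y).mp hy
  simp only [Pi.add_apply, Pi.smul_apply, smul_eq_mul] at h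
  obtain ⟨⟨⟨i1, h1, h1'⟩, ⟨i2, h2, h2'⟩⟩, ⟨i3, h3, h3'⟩, ⟨i4, h4, h4'⟩⟩ := hQ
  simp only [Pi.neg_apply] at h3' h4'
  have k1 := h i1
  have k2 := h i2
  have k3 := h i3
  have k4 := h i4
  rw [max_eq_right (by omega)] at k1 k3
  rw [max_eq_left (by omega)] at k2 k4
  rcases lt_trichotomy n 0 with hn | hn | hn
  · have : m ≤ 0 := by
      by_contra hc
      nlinarith
    nlinarith
  · subst hn
    have e1 : m ≤ 1 := by
      by_contra hc
      nlinarith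
    have e2 : 0 ≤ m := by
      by_contra hc
      nlinarith
    have : m = 0 ∨ m = 1 := by omega
    rcases this with rfl | rfl
    · left; simp
    · right; simp
  · have : m ≤ 0 := by
      by_contra hc
      nlinarith
    nlinarith

lemma iso_ab (hB : Bas L a b) (hQ : Quad a b) : Iso L (a + b) := by
  intro y hy h
  obtain ⟨m, n, rfl⟩ := (hB.mem y).mp hy
  simp only [Pi.add_apply, Pi.smul_apply, smul_eq_mul] at h
  obtain ⟨⟨⟨i1, h1, h1'⟩, ⟨i2, h2, h2'⟩⟩, ⟨i3, h3, h3'⟩, ⟨i4, h4, h4'⟩⟩ := hQ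
  simp only [Pi.neg_apply] at h3' h4'
  have k1 := h i1
  have k2 := h i2
  have k3 := h i3
  have k4 := h i4
  rw [max_eq_right (by omega)] at k3
  rw [max_eq_left (by omega)] at k4
  have l1 : m * a i1 + n * b i1 ≤ 0 ∨ m * a i1 + n * b i1 ≤ a i1 + b i1 := by
    rcases max_choice 0 (a i1 + b i1) with e | e <;> rw [e] at k1 <;> tauto
  have l2 : m * a i2 + n * b i2 ≤ 0 ∨ m * a i2 + n * b i2 ≤ a i2 + b i2 := by
    rcases max_choice 0 (a i2 + b i2) with e | e <;> rw [e] at k2 <;> tauto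
  have c1 : ¬ (1 ≤ m ∧ n ≤ 0) := by
    rintro ⟨e1, e2⟩
    rcases l1 with l | l <;> nlinarith
  have c2 : ¬ (1 ≤ n ∧ m ≤ 0) := by
    rintro ⟨e1, e2⟩
    rcases l2 with l | l <;> nlinarith
  have c3 : ¬ (1 ≤ m ∧ 1 ≤ n ∧ 3 ≤ m + n) := by
    rintro ⟨e1, e2, e3⟩
    have : (m - 1) * a i3 + (n - 1) * b i3 ≤ 0 := by linarith
    rcases (by omega : 2 ≤ m ∨ 2 ≤ n) with e | e <;> nlinarith
  have c4 : ¬ (m ≤ 0 ∧ n ≤ 0 ∧ m + n ≤ -1) := by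
    rintro ⟨e1, e2, e3⟩
    rcases (by omega : m ≤ -1 ∨ n ≤ -1) with e | e <;> nlinarith
  have : (m = 0 ∧ n = 0) ∨ (m = 1 ∧ n = 1) := by omega
  rcases this with ⟨rfl, rfl⟩ | ⟨rfl, rfl⟩
  · left; simp
  · right; simp

/-- functional -/
def ph (z : σ → ℤ) (h : MvPolynomial σ K) : K := coeff (ex fun i => (z i).toNat) h

lemma ph_mn {z : σ → ℤ} (hI : Iso L z) {w : σ → ℤ} (hw : w ∈ L) (hw0 : w ≠ 0) (hwz : w ≠ z)
    (r : MvPolynomial σ K) : ph z (r * mn K (fun i => (w i).toNat)) = 0 := by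
  classical
  rw [ph, mn_eq, coeff_mul_monomial', if_neg]
  intro hle
  rcases hI w hw (fun i => by have := hle i; simp only [ex_apply] at this; omega) with h | h
  · exact hw0 h
  · exact hwz h

lemma ph_mn_self {z : σ → ℤ} (r : MvPolynomial σ K) :
    ph z (r * mn K (fun i => (z i).toNat)) = coeff 0 r := by
  classical
  rw [ph, mn_eq, coeff_mul_monomial', if_pos le_rfl]
  simp

lemma ph_fb {z : σ → ℤ} (hI : Iso L z) {w : σ → ℤ} (hw : w ∈ L) (hwz : w ≠ z) (hwz' : w ≠ -z)
    (r : MvPolynomial σ K) : ph z (r * fb K w) = 0 := by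
  by_cases hw0 : w = 0
  · subst hw0; simp [fb_zero, ph]
  have h1 := ph_mn hI hw hw0 hwz r
  have h2 := ph_mn hI (L.neg_mem hw) (neg_ne_zero.mpr hw0) (fun e => hwz' (by rw [← e, neg_neg])) r
  simp only [Pi.neg_apply] at h2
  rw [fb_def, mul_sub]
  unfold ph at *
  rw [coeff_sub, h1, h2, sub_zero]

lemma ph_self {z : σ → ℤ} (hI : Iso L z) (hz : z ∈ L) (hz0 : z ≠ 0)
    (r : MvPolynomial σ K) : ph z (r * fb K z) = coeff 0 r := by
  have hne : -z ≠ z := by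
    intro e
    apply hz0
    funext i
    have := congrFun e i
    simp only [Pi.neg_apply, Pi.zero_apply] at *
    omega
  have h1 := ph_mn_self (z := z) r
  have h2 := ph_mn hI (L.neg_mem hz) (neg_ne_zero.mpr hz0) hne r
  simp only [Pi.neg_apply] at h2
  rw [fb_def, mul_sub]
  unfold ph at *
  rw [coeff_sub, h1, h2, sub_zero]

lemma ph_lin {z : σ → ℤ} (hI : Iso L z) (hz : z ∈ L) (hz0 : z ≠ 0) {h : MvPolynomial σ K}
    (hh : h ∈ latticeIdeal K (L : Set (σ → ℤ))) :
    ∀ r : MvPolynomial σ K, ph z (r * h) = coeff 0 r * ph z h := by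
  have hadd : ∀ x y : MvPolynomial σ K, ph z (x + y) = ph z x + ph z y := fun x y => coeff_add _ _ _
  refine Submodule.span_induction (p := fun h _ => ∀ r, ph z (r * h) = coeff 0 r * ph z h)
    ?_ ?_ ?_ ?_ hh
  · rintro _ ⟨w, hw, rfl⟩ r
    change ph z (r * fb K w) = coeff 0 r * ph z (fb K w)
    have key : ∀ w' : σ → ℤ, w' ∈ L → w' ≠ -z → ∀ r : MvPolynomial σ K, ph z (r * fb K w') = coeff 0 r * ph z (fb K w') := by
      intro w' hw' hne r
      by_cases e : w' = z
      · subst e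
        rw [ph_self hI hz hz0]
        have := ph_self (K := K) hI hz hz0 1
        rw [one_mul] at this
        rw [this]; simp
      · rw [ph_fb hI hw' e hne]
        have := ph_fb (K := K) hI hw' e hne 1
        rw [one_mul] at this
        rw [this]; simp
    by_cases e : w = -z
    · have h0 := key (-w) (L.neg_mem hw) (by
        rw [e, neg_neg]; intro e'
        apply hz0; funext i
        have := congrFun e' i
        simp only [Pi.neg_apply, Pi.zero_apply] at *
        omega) r
      rw [fb_neg, mul_neg] at h0
      unfold ph at *
      rw [coeff_neg, coeff_neg, mul_neg] at h0
      exact neg_injective h0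
    · exact key w hw e r
  · intro r; simp [ph]
  · intro x y _ _ hx hy r
    rw [mul_add, hadd, hadd, hx, hy, mul_add]
  · intro c x _ hx r
    rw [smul_eq_mul, ← mul_assoc, hx, hx, ← constantCoeff_eq, map_mul, mul_assoc]

lemma rank_contra (hgen4 : ∃ f : Fin 4 → MvPolynomial σ K,
      latticeIdeal K (L : Set (σ → ℤ)) = Ideal.span (Set.range f))
    (v : Fin 5 → σ → ℤ) (hv : ∀ k, v k ∈ L) (h0 : ∀ k, v k ≠ 0) (hI : ∀ k, Iso L (v k))
    (hd : ∀ k l, k ≠ l → v k ≠ v l ∧ v k ≠ - v l) : False := by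
  obtain ⟨f, hf⟩ := hgen4
  have hmem : ∀ k, ∃ c : Fin 4 → MvPolynomial σ K, ∑ j, c j * f j = fb K (v k) := by
    intro k
    have h := fb_mem (K := K) (hv k)
    rw [hf] at h
    exact Ideal.mem_span_range_iff_exists_fun.mp h
  choose c hc using hmem
  have hfm : ∀ j, f j ∈ latticeIdeal K (L : Set (σ → ℤ)) := fun j => by
    rw [hf]; exact Ideal.subset_span ⟨j, rfl⟩
  let C : Matrix (Fin 5) (Fin 4) K := fun k j => coeff 0 (c k j)
  let P : Matrix (Fin 4) (Fin 5) K := fun j l => ph (v l) (f j)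
  have hCP : C * P = 1 := by
    ext k l
    rw [Matrix.mul_apply]
    have e1 : ∑ j, C k j * P j l = ph (v l) (fb K (v k)) := by
      rw [← hc k]
      simp only [C, P]
      conv_lhs => 
        enter [2, j]
        rw [← ph_lin (hI l) (hv l) (h0 l) (hfm j) (c k j)]
      simp only [ph, coeff_sum]
    rw [e1]
    by_cases e : k = l
    · subst e
      have := ph_self (K := K) (hI k) (hv k) (h0 k) 1
      rw [one_mul] at this
      rw [this]; simp
    · have := ph_fb (K := K) (hI l) (hv k) (hd k l e).1 (hd k l e).2 1
      rw [one_mul] at this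
      rw [this, Matrix.one_apply_ne e]
  have h1 := Matrix.rank_mul_le_left C P
  rw [hCP, Matrix.rank_one] at h1
  have h2 := Matrix.rank_le_width C
  simp at h1
  omega

lemma notE (hgen4 : ∃ f : Fin 4 → MvPolynomial σ K,
      latticeIdeal K (L : Set (σ → ℤ)) = Ideal.span (Set.range f))
    (hB : Bas L a b) (hQ : Quad a b) : ¬ E a (a + b) := by
  intro hE
  have hB1 := hB.neg
  let w : Fin 5 → ℤ × ℤ := ![(1,0),(0,1),(1,1),(1,-1),(2,1)]
  let v : Fin 5 → σ → ℤ := fun k => (w k).1 • a + (w k).2 • b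
  have hinj : ∀ p q : ℤ × ℤ, p.1 • a + p.2 • b = q.1 • a + q.2 • b → p = q := by
    intro p q h
    have := hB.ind (p.1 - q.1) (p.2 - q.2) (by
      have : (p.1 - q.1) • a + (p.2 - q.2) • b = (p.1 • a + p.2 • b) - (q.1 • a + q.2 • b) := by module
      rw [this, h, sub_self])
    ext <;> omega
  refine rank_contra hgen4 v (fun k => (hB.mem _).mpr ⟨_, _, rfl⟩) ?_ ?_ ?_
  · intro k hk
    have := hB.ind _ _ hk
    fin_cases k <;> simp [w] at this
  · intro k
    fin_cases k
    · have := iso_a hB hQ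
      simpa [v, w] using this
    · have := iso_a hB.swap hQ.swap
      simpa [v, w] using this
    · have := iso_ab hB hQ
      simpa [v, w] using this
    · have := iso_ab hB.neg hQ.neg
      simpa [v, w] using this
    · have := iso_ab hB.add (hQ.add hE)
      have e : v 4 = a + (a + b) := by
        simp only [v, w]
        have : (2:ℤ) • a + (1:ℤ) • b = a + (a + b) := by module
        simpa using this
      change Iso L (v 4)
      rw [e]; exact this
  · intro k l hkl
    constructor
    · intro h
      have := hinj (w k) (w l) h
      revert this hkl
      revert k l
      simp only [w]
      intro k l
      fin_cases k <;> fin_cases l <;> simp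
    · intro h
      have h' : (w k).1 • a + (w k).2 • b = (-(w l).1) • a + (-(w l).2) • b := by
        have e : (-(w l).1) • a + (-(w l).2) • b = - v l := by simp only [v]; module
        rw [e]; exact h
      have := hinj (w k) (-(w l).1, -(w l).2) h'
      revert this hkl
      clear h h'
      revert k l
      simp only [w]
      intro k l
      fin_cases k <;> fin_cases l <;> simp

/-- everything from generators -/
structure Sit (K : Type) [Field K] (L : AddSubgroup (σ → ℤ)) (a b : σ → ℤ) : Prop where
  bas : Bas L a b
  quad : Quad a b
  n1 : ¬ E a (a + b)
  n2 : ¬ E (a + b) b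
  n3 : ¬ E a (a - b)
  n4 : ¬ E (a - b) (-b)
  le : latticeIdeal K (L : Set (σ → ℤ)) ≤ Ideal.span {fb K a, fb K b, fb K (a + b), fb K (a - b)}

lemma exists_sit (hgen4 : ∃ f : Fin 4 → MvPolynomial σ K,
      latticeIdeal K (L : Set (σ → ℤ)) = Ideal.span (Set.range f))
    (hB : Bas L a b) (hQ : Quad a b) : Sit K L a b := by
  have n1 := notE hgen4 hB hQ
  have n2 : ¬ E (a + b) b := by
    intro h
    have := notE hgen4 hB.swap hQ.swap
    rw [add_comm] at this
    exact this h.swap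
  have n3 := notE hgen4 hB.neg hQ.neg
  have n4 : ¬ E (a + -b) (-b) := by
    intro h
    have := notE hgen4 hB.neg.swap hQ.neg.swap
    rw [add_comm] at this
    exact this h.swap
  refine ⟨hB, hQ, n1, n2, by rwa [sub_eq_add_neg], by rwa [sub_eq_add_neg], ?_⟩
  have ma : fb K a ∈ Ideal.span {fb K a, fb K b, fb K (a + b), fb K (a - b)} := Ideal.subset_span (by simp)
  have mb : fb K b ∈ Ideal.span {fb K a, fb K b, fb K (a + b), fb K (a - b)} := Ideal.subset_span (by simp)
  have mab : fb K (a + b) ∈ Ideal.span {fb K a, fb K b, fb K (a + b), fb K (a - b)} := Ideal.subset_span (by simp)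
  have mab' : fb K (a + -b) ∈ Ideal.span {fb K a, fb K b, fb K (a + b), fb K (a - b)} := Ideal.subset_span (by simp [sub_eq_add_neg])
  have mb' : fb K (-b) ∈ Ideal.span {fb K a, fb K b, fb K (a + b), fb K (a - b)} := neg_mem (by rwa [neg_neg])
  exact lattice_le hB (quadrant ma mb mab n1 n2) (quadrant ma mb' mab' n3 n4)

lemma exists_bas (hrk : Module.finrank ℤ ↥(AddSubgroup.toIntSubmodule L) = 2) : ∃ a b, Bas L a b := by
  let B := Module.finBasisOfFinrankEq ℤ ↥(AddSubgroup.toIntSubmodule L) hrk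
  refine ⟨(B 0 : σ → ℤ), (B 1 : σ → ℤ), ?_, ?_⟩
  · intro z
    constructor
    · intro hz
      have := B.sum_repr ⟨z, hz⟩
      rw [Fin.sum_univ_two] at this
      exact ⟨_, _, (congrArg Subtype.val this).symm⟩
    · rintro ⟨m, n, rfl⟩
      exact L.add_mem (L.zsmul_mem (B 0).2 m) (L.zsmul_mem (B 1).2 n)
  · intro m n h
    have := B.linearIndependent
    rw [Fintype.linearIndependent_iff] at this
    have := this ![m, n] (by
      rw [Fin.sum_univ_two]
      apply Subtype.ext
      simpa using h)
    exact ⟨this 0, this 1⟩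
end lat2
end Pf

namespace Pf
section lat3
variable {K : Type} [Field K] {σ : Type} [Fintype σ]
variable {L : AddSubgroup (σ → ℤ)} {a b : σ → ℤ}

/-- disjoint supports -/
def Dj (e f : σ → ℕ) : Prop := ∀ i, e i = 0 ∨ f i = 0

lemma Dj.symm {e f : σ → ℕ} (h : Dj e f) : Dj f e := fun i => (h i).symm

lemma mem_mn_span (S : Set (σ → ℕ)) (h : MvPolynomial σ K) :
    h ∈ Ideal.span (mn K '' S) ↔ ∀ u ∈ h.support, ∃ e ∈ S, ∀ i, e i ≤ u i := by
  have e1 : mn K '' S = (fun s => monomial s (1 : K)) '' (ex '' S) := by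
    rw [Set.image_image]; apply Set.image_congr; intro e _; exact mn_eq e
  rw [e1, mem_ideal_span_monomial_image]
  simp only [Set.exists_mem_image]
  rfl

lemma span_disj (S : Set (σ → ℕ)) (m : σ → ℕ) (hd : ∀ e ∈ S, Dj e m) (h : MvPolynomial σ K)
    (hh : h * mn K m ∈ Ideal.span (mn K '' S)) : h ∈ Ideal.span (mn K '' S) := by
  rw [mem_mn_span] at hh ⊢
  intro u hu
  obtain ⟨e, he, hle⟩ := hh (u + ex m) (by
    rw [mem_support_iff, mn_eq, coeff_mul_monomial, mul_one]
    exact mem_support_iff.mp hu)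
  refine ⟨e, he, fun i => ?_⟩
  have h1 := hle i
  have h2 := hd e he i
  simp only [Finsupp.add_apply, ex_apply] at h1
  omega

lemma mn_ne (e : σ → ℕ) : mn K e ≠ 0 := by
  rw [mn_eq]; simp

lemma cop_mn {e f : σ → ℕ} (h : Dj e f) : Cop (mn K e) (mn K f) := by
  intro x y hxy
  have : x ∈ Ideal.span (mn K '' {f}) := by
    apply span_disj {f} e (fun f' hf => by rw [Set.mem_singleton_iff.mp hf]; exact h.symm)
    rw [hxy, Set.image_singleton]
    exact Ideal.mul_mem_left _ _ (Ideal.mem_span_singleton_self _)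
  rw [Set.image_singleton, Ideal.mem_span_singleton'] at this
  obtain ⟨t, ht⟩ := this
  refine ⟨t, ht.symm, ?_⟩
  apply mul_right_cancel₀ (mn_ne (K := K) f)
  rw [← hxy, ← ht]; ring

lemma wreg_mn (es : List (σ → ℕ)) (h : es.Pairwise Dj) :
    RingTheory.Sequence.IsWeaklyRegular (MvPolynomial σ K) (es.map (mn K)) := by
  constructor
  intro i hi
  have e1 : (Ideal.ofList ((es.map (mn K)).take i) • ⊤ : Submodule (MvPolynomial σ K) (MvPolynomial σ K))
      = Ideal.span (mn K '' {e | e ∈ es.take i}) := by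
    rw [smul_eq_mul, Ideal.mul_top, Ideal.ofList]
    congr 1
    ext x
    rw [Set.mem_image, ← List.map_take]
    exact List.mem_map
  rw [e1]
  have hi' : i < es.length := by simpa using hi
  have : (es.map (mn K))[i] = mn K es[i] := by simp
  rw [this]
  refine IsSMulRegular.of_right_eq_zero_of_smul ?_
  intro x hx
  obtain ⟨x, rfl⟩ := Submodule.Quotient.mk_surjective _ x
  rw [← Submodule.Quotient.mk_smul, Submodule.Quotient.mk_eq_zero] at hx
  rw [Submodule.Quotient.mk_eq_zero]
  refine span_disj _ es[i] ?_ x (by rw [mul_comm]; exact hx)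
  intro e he
  rw [Set.mem_ofPred_eq, List.mem_take_iff_getElem] at he
  obtain ⟨j, hj, rfl⟩ := he
  exact List.pairwise_iff_getElem.mp h j i _ hi' (by omega)

/-! nonzerodivisor mod two monomials -/

def NZ {R : Type} [CommRing R] (F P Q : R) : Prop := ∀ h a b, h * F = a * P + b * Q → ∃ u v, h = u * P + v * Q
def ZD {R : Type} [CommRing R] (P Q : R) : Prop := ∀ a b, a * P = b * Q → ∃ t, a = t * Q

lemma NZ.mul {R : Type} [CommRing R] {F P P' Q : R} (h1 : NZ F P Q) (h2 : NZ F P' Q) (hz : ZD P Q) :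
    NZ F (P * P') Q := by
  intro h x y e
  obtain ⟨u, v, rfl⟩ := h1 h (x * P') y (by rw [e]; ring)
  obtain ⟨c, hc⟩ := hz (u * F - x * P') (y - v * F) (by linear_combination e)
  obtain ⟨u', v', rfl⟩ := h2 u x c (by linear_combination hc)
  exact ⟨u', v' * P + v, by ring⟩

lemma ZD.mul {R : Type} [CommRing R] {P P' Q : R} (h1 : ZD P Q) (h2 : ZD P' Q) : ZD (P * P') Q := by
  intro x y e
  obtain ⟨t, ht⟩ := h2 (x * P) y (by rw [← e]; ring)
  obtain ⟨t', ht'⟩ := h1 x t ht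
  exact ⟨t', ht'⟩

lemma NZ.symm {R : Type} [CommRing R] {F P Q : R} (h : NZ F P Q) : NZ F Q P := by
  intro x y z e
  obtain ⟨u, v, h⟩ := h x z y (by rw [e]; ring)
  exact ⟨v, u, by rw [h]; ring⟩

lemma nz_prod {F Q : MvPolynomial σ K} (e : σ → ℕ)
    (h : ∀ i, e i ≠ 0 → NZ F (X i) Q ∧ ZD (X i) Q) : NZ F (mn K e) Q := by
  have h1 : NZ F 1 Q ∧ ZD 1 Q :=
    ⟨fun h _ _ _ => ⟨h, 0, by ring⟩, fun a b e => ⟨b, by rw [← e, mul_one]⟩⟩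
  have hm : ∀ P P', (NZ F P Q ∧ ZD P Q) → (NZ F P' Q ∧ ZD P' Q) → (NZ F (P * P') Q ∧ ZD (P * P') Q) :=
    fun P P' h h' => ⟨h.1.mul h'.1 h.2, h.2.mul h'.2⟩
  refine (Finset.prod_induction (fun i => (X i : MvPolynomial σ K) ^ e i) (fun P => NZ F P Q ∧ ZD P Q) hm h1 ?_).1
  intro i _
  by_cases hi : e i = 0
  · rw [hi, pow_zero]; exact h1
  · have := h i hi
    generalize e i = k
    induction k with
    | zero => rw [pow_zero]; exact h1
    | succ k ih => rw [pow_succ]; exact hm _ _ ih this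

lemma X_mn [DecidableEq σ] (i : σ) : (X i : MvPolynomial σ K) = mn K (Pi.single i 1) := by
  rw [mn_eq]
  have : ex (Pi.single i 1) = Finsupp.single i 1 := by
    ext j; simp [ex_apply, Finsupp.single_apply, Pi.single_apply, eq_comm]
  rw [this]; rfl

lemma Cop.zd {R : Type} [CommRing R] {P Q : R} (h : Cop P Q) : ZD P Q := fun x y e => by
  obtain ⟨t, h, _⟩ := h x y e
  exact ⟨t, h⟩

lemma mem_pair {R : Type} [CommRing R] {h P Q : R} : h ∈ Ideal.span {P, Q} ↔ ∃ u v, h = u * P + v * Q := by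
  rw [Ideal.mem_span_pair]
  constructor <;> rintro ⟨u, v, e⟩ <;> exact ⟨u, v, e.symm⟩

lemma prime_pair (S : Set σ) : (Ideal.span (X '' S : Set (MvPolynomial σ K))).IsPrime := by
  classical
  let θ : MvPolynomial σ K →ₐ[K] MvPolynomial σ K := aeval (fun k => if k ∈ S then 0 else X k)
  have h : Ideal.span (X '' S : Set (MvPolynomial σ K)) = RingHom.ker θ := by
    apply le_antisymm
    · rw [Ideal.span_le]
      rintro _ ⟨k, hk, rfl⟩
      change θ (X k) = 0
      simp [θ, hk]
    · intro h hh
      have e : (Ideal.Quotient.mkₐ K (Ideal.span (X '' S : Set (MvPolynomial σ K)))).comp θ =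
          Ideal.Quotient.mkₐ K (Ideal.span (X '' S : Set (MvPolynomial σ K))) := by
        apply MvPolynomial.algHom_ext
        intro k
        by_cases hk : k ∈ S
        · simp only [AlgHom.comp_apply, θ, aeval_X, if_pos hk, map_zero]
          symm
          exact Ideal.Quotient.eq_zero_iff_mem.mpr (Ideal.subset_span ⟨k, hk, rfl⟩)
        · simp [θ, hk]
      have h2 := congrArg (fun f => f h) e
      simp only [AlgHom.comp_apply] at h2
      rw [(RingHom.mem_ker.mp hh : θ h = 0), map_zero] at h2
      exact Ideal.Quotient.eq_zero_iff_mem.mp h2.symm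
  rw [h]
  exact RingHom.ker_isPrime _

lemma pm_ne {w : σ → ℤ} (hw : w ≠ 0) : ex (fun i => (w i).toNat) ≠ ex (fun i => (-(w i)).toNat) := by
  intro h
  apply hw
  funext i
  have := congrFun (ex_inj h) i
  simp only [Pi.zero_apply] at *
  omega

lemma supp_pos {w : σ → ℤ} (hw : w ≠ 0) : ex (fun i => (w i).toNat) ∈ (fb K w).support := by
  classical
  rw [mem_support_iff, fb_def, mn_eq, mn_eq, coeff_sub, coeff_monomial, coeff_monomial, if_pos rfl,
    if_neg (pm_ne hw).symm]
  simp

lemma supp_neg {w : σ → ℤ} (hw : w ≠ 0) : ex (fun i => (-(w i)).toNat) ∈ (fb K w).support := by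
  classical
  rw [mem_support_iff, fb_def, mn_eq, mn_eq, coeff_sub, coeff_monomial, coeff_monomial, if_pos rfl,
    if_neg (pm_ne hw)]
  simp

lemma fb_ne {w : σ → ℤ} (hw : w ≠ 0) : fb K w ≠ 0 := by
  intro h
  have := supp_pos (K := K) hw
  rw [h] at this
  simp at this

lemma nz_base {w : σ → ℤ} {i j : σ} (hw : w ≠ 0) (h1 : ¬ (0 < w i ∧ w j < 0)) (h2 : ¬ (w i < 0 ∧ 0 < w j)) :
    NZ (fb K w) (X i) (X j) := by
  intro h x y e
  have hp := prime_pair (K := K) ({i, j} : Set σ)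
  have hm : h * fb K w ∈ Ideal.span (X '' ({i, j} : Set σ) : Set (MvPolynomial σ K)) := by
    rw [Set.image_pair, mem_pair]; exact ⟨x, y, e⟩
  rcases hp.mem_or_mem hm with h' | h'
  · rwa [Set.image_pair, mem_pair] at h'
  · exfalso
    rw [mem_ideal_span_X_image] at h'
    have a1 := h' _ (supp_pos hw)
    have a2 := h' _ (supp_neg hw)
    simp only [Set.mem_insert_iff, Set.mem_singleton_iff, exists_eq_or_imp, exists_eq_left, ex_apply] at a1 a2
    omega

lemma nz_full {w : σ → ℤ} {e f : σ → ℕ} (hw : w ≠ 0) (hd : Dj e f)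
    (h : ∀ i j, e i ≠ 0 → f j ≠ 0 → ¬ (0 < w i ∧ w j < 0) ∧ ¬ (w i < 0 ∧ 0 < w j)) :
    NZ (fb K w) (mn K e) (mn K f) := by
  classical
  have hs : ∀ i, ∀ g : σ → ℕ, g i = 0 → Dj (Pi.single i 1) g := by
    intro i g hg j
    by_cases hj : j = i
    · subst hj; right; exact hg
    · left; simp [hj]
  apply nz_prod
  intro i hi
  refine ⟨?_, ?_⟩
  · apply NZ.symm
    apply nz_prod
    intro j hj
    refine ⟨(nz_base hw (h i j hi hj).1 (h i j hi hj).2).symm, ?_⟩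
    rw [X_mn, X_mn]
    apply Cop.zd
    apply cop_mn
    apply hs
    by_cases hij : i = j
    · subst hij; have := hd i; tauto
    · simp [Ne.symm hij]
  · rw [X_mn]
    apply Cop.zd
    apply cop_mn
    apply hs
    have := hd i; tauto

/-! coprimality -/

lemma X_ndvd {w : σ → ℤ} (hw : w ≠ 0) (i : σ) : ¬ (X i : MvPolynomial σ K) ∣ fb K w := by
  intro h
  have h' : fb K w ∈ Ideal.span (X '' ({i} : Set σ) : Set (MvPolynomial σ K)) := by
    rw [Set.image_singleton, Ideal.mem_span_singleton]; exact h
  rw [mem_ideal_span_X_image] at h'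
  have a1 := h' _ (supp_pos hw)
  have a2 := h' _ (supp_neg hw)
  simp only [Set.mem_singleton_iff, exists_eq_left, ex_apply] at a1 a2
  omega

lemma prime_dvd_all (hB : Bas L a b) {h : MvPolynomial σ K} (hp : Prime h) (ha : h ∣ fb K a) (hb : h ∣ fb K b)
    (ha0 : a ≠ 0) : ∀ z ∈ L, h ∣ fb K z := by
  have hX : ∀ i, ¬ h ∣ X i := by
    intro i hi
    have hx : Prime (X i : MvPolynomial σ K) := X_prime
    have := hp.associated_of_dvd hx hi
    exact X_ndvd ha0 i (this.symm.dvd.trans ha)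
  have hmn : ∀ e, ¬ h ∣ mn K e := by
    intro e he
    obtain ⟨i, _, hi⟩ := (hp.dvd_finsetProd_iff _).mp he
    exact hX i (hp.dvd_of_dvd_pow hi)
  have hadd : ∀ u v : σ → ℤ, h ∣ fb K u → h ∣ fb K v → h ∣ fb K (u + v) := by
    intro u v hu hv
    obtain ⟨C, D, hCD⟩ := path (K := K) u v
    have : h ∣ mn K (fun i => min (u i).toNat (-(v i)).toNat) * fb K (u + v) := by
      rw [hCD]; exact dvd_add (hu.mul_left _) (hv.mul_left _)
    exact (hp.dvd_or_dvd this).resolve_left (hmn _)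
  have hneg : ∀ u : σ → ℤ, h ∣ fb K u → h ∣ fb K (-u) := by
    intro u hu; rw [fb_neg]; exact (dvd_neg).mpr hu
  let S : AddSubgroup (σ → ℤ) :=
    { carrier := {u | h ∣ fb K u}
      add_mem' := fun {u v} hu hv => hadd u v hu hv
      zero_mem' := by change h ∣ fb K 0; rw [fb_zero]; exact dvd_zero _
      neg_mem' := fun {u} hu => hneg u hu }
  intro z hz
  obtain ⟨m, n, rfl⟩ := (hB.mem z).mp hz
  exact S.add_mem (S.zsmul_mem (x := a) ha m) (S.zsmul_mem (x := b) hb n)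

lemma relprime (hB : Bas L a b) : IsRelPrime (fb K a) (fb K b) := by
  classical
  have ha0 : a ≠ 0 := by
    intro h
    have := hB.ind 1 0 (by simp [h])
    omega
  rw [UniqueFactorizationMonoid.isRelPrime_iff_no_prime_factors (fb_ne ha0)]
  intro h ha hb hp
  have hall := prime_dvd_all hB hp ha hb ha0
  apply hp.not_isUnit
  have hdeg : ∀ k, degreeOf k h = 0 := by
    intro k
    obtain ⟨z, hz, hz0, hzk⟩ : ∃ z ∈ L, z ≠ 0 ∧ z k = 0 := by
      by_cases hk : a k = 0
      · exact ⟨a, hB.a_mem, ha0, hk⟩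
      · refine ⟨(b k) • a + (-(a k)) • b, (hB.mem _).mpr ⟨_, _, rfl⟩, ?_, ?_⟩
        · intro e
          have := hB.ind _ _ e
          omega
        · simp; ring
    obtain ⟨c, hc⟩ := hall z hz
    have hd : degreeOf k (fb K z) = 0 := by
      apply Nat.eq_zero_of_le_zero
      refine (degreeOf_sub_le k _ _).trans ?_
      have := mn_eq (K := K) (fun i => (z i).toNat)
      have := mn_eq (K := K) (fun i => (-(z i)).toNat)
      change max (degreeOf k (mn K (fun i => (z i).toNat))) (degreeOf k (mn K (fun i => (-(z i)).toNat))) ≤ 0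
      rw [mn_eq, mn_eq, degreeOf_monomial_eq _ _ one_ne_zero, degreeOf_monomial_eq _ _ one_ne_zero]
      simp [ex_apply, hzk]
    have hc0 : c ≠ 0 := by
      rintro rfl
      exact fb_ne hz0 (by rw [hc, mul_zero])
    rw [hc, degreeOf_mul_eq hp.ne_zero hc0] at hd
    omega
  have hC : h = C (coeff 0 h) := by
    ext m
    rw [coeff_C]
    split_ifs with hm
    · rw [hm]
    · by_contra hne
      apply hm
      ext k
      have := le_degreeOf_of_mem_support k (mem_support_iff.mpr hne)
      rw [hdeg k] at this
      simp only [Finsupp.coe_zero, Pi.zero_apply]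
      omega
  have hne : coeff 0 h ≠ 0 := by
    intro e
    rw [e, map_zero] at hC
    exact hp.ne_zero hC
  rw [hC]
  exact (isUnit_iff_ne_zero.mpr hne).map C

lemma relprime_syz {R : Type} [CommRing R] [IsDomain R] [UniqueFactorizationMonoid R] {A B : R} (h : IsRelPrime A B) (hB : B ≠ 0)
    (x y : R) (e : x * A + y * B = 0) : ∃ t, x = t * B ∧ y = -(t * A) := by
  have h1 : B ∣ x * A := ⟨-y, by linear_combination e⟩
  obtain ⟨t, ht⟩ := h.symm.dvd_of_dvd_mul_right h1
  refine ⟨t, by rw [ht]; ring, ?_⟩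
  apply mul_right_cancel₀ hB
  rw [ht] at e
  linear_combination e

/-! monomials are nonzerodivisors mod the lattice ideal -/

lemma mn_sub_mem {e f : σ → ℕ} (h : (fun i => (e i : ℤ) - f i) ∈ L) :
    mn K e - mn K f ∈ latticeIdeal K (L : Set (σ → ℤ)) := by
  have : mn K e - mn K f = mn K (fun i => min (e i) (f i)) * fb K (fun i => (e i : ℤ) - f i) := by
    rw [fb_def, mul_sub, mn_mul _ _ e (fun i => by omega), mn_mul _ _ f (fun i => by omega)]
  rw [this]
  exact Ideal.mul_mem_left _ _ (fb_mem h)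

lemma mn_nzd (m : σ → ℕ) (h : MvPolynomial σ K) (hh : h * mn K m ∈ latticeIdeal K (L : Set (σ → ℤ))) :
    h ∈ latticeIdeal K (L : Set (σ → ℤ)) := by
  classical
  let Q := (σ → ℤ) ⧸ L
  let q : (σ → ℕ) → Q := fun e => QuotientAddGroup.mk (fun i => (e i : ℤ))
  let Ψ : MvPolynomial σ K →ₐ[K] AddMonoidAlgebra K Q :=
    aeval (fun i => AddMonoidAlgebra.single (q (Pi.single i 1)) 1)
  have hΨ : ∀ e, Ψ (mn K e) = AddMonoidAlgebra.single (q e) 1 := by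
    intro e
    have : ∀ s : Finset σ, Ψ (∏ i ∈ s, X i ^ e i) = AddMonoidAlgebra.single (∑ i ∈ s, e i • q (Pi.single i 1)) 1 := by
      intro s
      induction s using Finset.induction_on with
      | empty => rw [Finset.prod_empty, map_one, Finset.sum_empty]; rfl
      | insert i s hi ih =>
        rw [Finset.prod_insert hi, Finset.sum_insert hi, map_mul, ih, map_pow]
        simp [Ψ, AddMonoidAlgebra.single_pow, AddMonoidAlgebra.single_mul_single]
    have h2 := this Finset.univ
    rw [mn, h2]
    congr 1
    have e3 : (fun i => (e i : ℤ)) = ∑ i, e i • (fun k => ((Pi.single i 1 : σ → ℕ) k : ℤ)) := by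
      funext k
      simp [Finset.sum_apply, Pi.single_apply]
    simp only [q]
    rw [e3]
    simp
  have hker : ∀ h, Ψ h = 0 ↔ h ∈ latticeIdeal K (L : Set (σ → ℤ)) := by
    intro h
    constructor
    · intro h0
      let I := latticeIdeal K (L : Set (σ → ℤ))
      let c : Q → (MvPolynomial σ K ⧸ I) := fun x =>
        if hx : ∃ e, q e = x then Ideal.Quotient.mk I (mn K hx.choose) else 0
      let s : AddMonoidAlgebra K Q →ₗ[K] (MvPolynomial σ K ⧸ I) :=
        (Finsupp.linearCombination K c).comp (AddMonoidAlgebra.coeffLinearEquiv K).toLinearMap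
      have hs : s.comp Ψ.toLinearMap = (Ideal.Quotient.mkₐ K I).toLinearMap := by
        apply MvPolynomial.linearMap_ext
        intro u
        ext
        simp only [LinearMap.comp_apply, AlgHom.toLinearMap_apply]
        have hu : (monomial u (1:K)) = mn K u := by
          rw [mn_eq]; exact congrArg (fun v => monomial v (1:K)) (Finsupp.ext fun i => rfl)
        rw [hu, hΨ]
        have hx : ∃ e, q e = q u := ⟨u, rfl⟩
        have : s (AddMonoidAlgebra.single (q u) 1) = c (q u) := by
          simp [s]
        rw [this]
        simp only [c, dif_pos hx]
        change Ideal.Quotient.mk I _ = Ideal.Quotient.mk I _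
        rw [Ideal.Quotient.eq]
        apply mn_sub_mem
        have := hx.choose_spec
        have h3 := (QuotientAddGroup.eq).mp this.symm
        convert h3 using 1
        funext i
        simp; ring
      have h2 := congrArg (fun f => f h) hs
      simp only [LinearMap.comp_apply, AlgHom.toLinearMap_apply, h0, map_zero] at h2
      exact Ideal.Quotient.eq_zero_iff_mem.mp h2.symm
    · intro hh
      have : latticeIdeal K (L : Set (σ → ℤ)) ≤ RingHom.ker Ψ := by
        rw [latticeIdeal, Ideal.span_le]
        rintro _ ⟨w, hw, rfl⟩
        change Ψ (fb K w) = 0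
        rw [fb_def, map_sub, hΨ, hΨ, sub_eq_zero]
        congr 1
        apply QuotientAddGroup.eq.mpr
        convert L.neg_mem hw using 1
        funext i
        simp only [Pi.add_apply, Pi.neg_apply]
        omega
      exact this hh
  rw [← hker] at hh ⊢
  rw [map_mul, hΨ] at hh
  have := congrArg (fun x => x * AddMonoidAlgebra.single (-(q m)) (1:K)) hh
  simpa [mul_assoc, AddMonoidAlgebra.single_mul_single, ← AddMonoidAlgebra.one_def] using this

end lat3
end Pf

namespace Pf
section lat4
variable {K : Type} [Field K] {σ : Type} [Fintype σ]
variable {L : AddSubgroup (σ → ℤ)} {a b : σ → ℤ}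

def xp (a b : σ → ℤ) (i : σ) : ℕ := min (a i).toNat (b i).toNat
def xq (a b : σ → ℤ) (i : σ) : ℕ := min (-(a i)).toNat (-(b i)).toNat
def xr (a b : σ → ℤ) (i : σ) : ℕ := min (a i).toNat (-(b i)).toNat
def xs (a b : σ → ℤ) (i : σ) : ℕ := min (-(a i)).toNat (b i).toNat
def x1 (a b : σ → ℤ) (i : σ) : ℕ := (a i).toNat - (b i).natAbs
def x2 (a b : σ → ℤ) (i : σ) : ℕ := (-(a i)).toNat - (b i).natAbs
def x3 (a b : σ → ℤ) (i : σ) : ℕ := (b i).toNat - (a i).natAbs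
def x4 (a b : σ → ℤ) (i : σ) : ℕ := (-(b i)).toNat - (a i).natAbs

/-- the four monomials -/
def gg (K : Type) [Field K] (a b : σ → ℤ) : Fin 4 → MvPolynomial σ K :=
  ![mn K (xp a b), mn K (xq a b), mn K (xr a b), mn K (xs a b)]

/-- the data attached to a lattice. -/
def mkD (K : Type) [Field K] (L : AddSubgroup (σ → ℤ)) (a b : σ → ℤ) : Dat (MvPolynomial σ K) where
  p := mn K (xp a b)
  q := mn K (xq a b)
  r := mn K (xr a b)
  s := mn K (xs a b)
  e1 := mn K (x1 a b)
  e2 := mn K (x2 a b)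
  e3 := mn K (x3 a b)
  e4 := mn K (x4 a b)
  I := latticeIdeal K (L : Set (σ → ℤ))
  J := Ideal.span (Set.range (gg K a b))

lemma mkD_A : (mkD K L a b).A = fb K a := by
  simp only [Dat.A, mkD, fb_def, ← mn_add]
  congr 2 <;> funext i <;> simp only [xp, xq, xr, xs, x1, x2, x3, x4] <;> omega

lemma mkD_B : (mkD K L a b).B = fb K b := by
  simp only [Dat.B, mkD, fb_def, ← mn_add]
  congr 2 <;> funext i <;> simp only [xp, xq, xr, xs, x1, x2, x3, x4] <;> omega

lemma mkD_F : (mkD K L a b).F = fb K (a + b) := by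
  simp only [Dat.F, mkD, fb_def, pow_two, ← mn_add]
  congr 2 <;> funext i <;> simp only [xp, xq, xr, xs, x1, x2, x3, x4, Pi.add_apply] <;> omega

lemma mkD_G : (mkD K L a b).G = fb K (a - b) := by
  simp only [Dat.G, mkD, fb_def, pow_two, ← mn_add]
  congr 2 <;> funext i <;> simp only [xp, xq, xr, xs, x1, x2, x3, x4, Pi.sub_apply] <;> omega

lemma pw (a b : σ → ℤ) : [xp a b, xq a b, xr a b, xs a b].Pairwise Dj := by
  simp only [List.pairwise_cons, List.mem_cons, List.not_mem_nil, or_false, forall_eq_or_imp, forall_eq,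
    List.Pairwise.nil, and_true, IsEmpty.forall_iff, implies_true]
  refine ⟨⟨?_, ?_, ?_⟩, ⟨?_, ?_⟩, ?_⟩ <;> intro i <;> simp only [xp, xq, xr, xs] <;> omega

lemma good (h : Sit K L a b) : (mkD K L a b).Good := by
  have ha0 : a ≠ 0 := by
    intro e; have := h.bas.ind 1 0 (by simp [e]); omega
  have hb0 : b ≠ 0 := by
    intro e; have := h.bas.ind 0 1 (by simp [e]); omega
  have hab0 : a + b ≠ 0 := by
    intro e; have := h.bas.ind 1 1 (by simp [e]); omega
  have hab0' : a - b ≠ 0 := by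
    intro e; have := h.bas.ind 1 (-1) (by rw [← e]; module); omega
  have hpw := pw a b
  have d01 : Dj (xp a b) (xq a b) := List.pairwise_iff_getElem.mp hpw 0 1 (by simp) (by simp) (by simp)
  have d23 : Dj (xr a b) (xs a b) := List.pairwise_iff_getElem.mp hpw 2 3 (by simp) (by simp) (by simp)
  have d02 : Dj (xp a b) (xr a b) := List.pairwise_iff_getElem.mp hpw 0 2 (by simp) (by simp) (by simp)
  have d03 : Dj (xp a b) (xs a b) := List.pairwise_iff_getElem.mp hpw 0 3 (by simp) (by simp) (by simp)
  have d12 : Dj (xq a b) (xr a b) := List.pairwise_iff_getElem.mp hpw 1 2 (by simp) (by simp) (by simp)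
  have d13 : Dj (xq a b) (xs a b) := List.pairwise_iff_getElem.mp hpw 1 3 (by simp) (by simp) (by simp)
  constructor
  · intro ρ
    rw [mkD_A, mkD_B, mkD_F, mkD_G]
    change ρ ∈ latticeIdeal K (L : Set (σ → ℤ)) ↔ _
    constructor
    · intro hρ
      have := h.le hρ
      rw [Ideal.mem_span_insert] at this
      obtain ⟨x, z, hz, rfl⟩ := this
      rw [Ideal.mem_span_insert] at hz
      obtain ⟨y, z, hz, rfl⟩ := hz
      rw [Ideal.mem_span_pair] at hz
      obtain ⟨u, v, rfl⟩ := hz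
      exact ⟨x, y, u, v, by ring⟩
    · rintro ⟨x, y, u, v, rfl⟩
      have m1 := fb_mem (K := K) h.bas.a_mem
      have m2 := fb_mem (K := K) h.bas.b_mem
      have m3 := fb_mem (K := K) (L.add_mem h.bas.a_mem h.bas.b_mem)
      have m4 := fb_mem (K := K) (L.sub_mem h.bas.a_mem h.bas.b_mem)
      exact Ideal.add_mem _ (Ideal.add_mem _ (Ideal.add_mem _ (Ideal.mul_mem_left _ _ m1)
        (Ideal.mul_mem_left _ _ m2)) (Ideal.mul_mem_left _ _ m3)) (Ideal.mul_mem_left _ _ m4)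
  · intro ρ
    change ρ ∈ Ideal.span (Set.range (gg K a b)) ↔ _
    rw [Ideal.mem_span_range_iff_exists_fun]
    constructor
    · rintro ⟨c, hc⟩
      refine ⟨c 0, c 1, c 2, c 3, ?_⟩
      rw [← hc, Fin.sum_univ_four]
      rfl
    · rintro ⟨x, y, u, v, rfl⟩
      refine ⟨![x, y, u, v], ?_⟩
      rw [Fin.sum_univ_four]
      rfl
  · exact wreg_mn _ hpw
  · exact cop_mn d01
  · exact cop_mn d23
  · intro x y z e
    simp only [mkD] at e ⊢
    have := span_disj (K := K) {xp a b, xq a b} (xr a b) (by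
      rintro e' (rfl | rfl)
      · exact d02
      · exact d12) z (by
        rw [Set.image_pair, mem_pair]
        exact ⟨-x, -y, by linear_combination e⟩)
    rwa [Set.image_pair, mem_pair] at this
  · intro x y z w e
    simp only [mkD] at e ⊢
    have := span_disj (K := K) {xp a b, xq a b, xr a b} (xs a b) (by
      rintro e' (rfl | rfl | rfl)
      · exact d03
      · exact d13
      · exact d23) w (by
        rw [Set.image_insert_eq, Set.image_pair, Ideal.mem_span_insert]
        exact ⟨-x, _, mem_pair.mpr ⟨-y, -z, rfl⟩, by linear_combination e⟩)
    rw [Set.image_insert_eq, Set.image_pair, Ideal.mem_span_insert] at this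
    obtain ⟨u, t, ht, rfl⟩ := this
    obtain ⟨v, w, rfl⟩ := mem_pair.mp ht
    exact ⟨u, v, w, by ring⟩
  · rw [mkD_A, mkD_B]
    exact relprime_syz (relprime h.bas) (fb_ne hb0)
  · rw [mkD_G]
    refine nz_full hab0' d01 ?_
    intro i j hi hj
    simp only [xp, xq] at hi hj
    refine ⟨fun ⟨k1, k2⟩ => h.n4 ⟨⟨i, k1, ?_⟩, ⟨j, k2, ?_⟩⟩, fun ⟨k1, k2⟩ => h.n3 ⟨⟨i, ?_, k1⟩, ⟨j, ?_, k2⟩⟩⟩ <;>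
      (try simp only [Pi.neg_apply]) <;> omega
  · rw [mkD_F]
    refine nz_full hab0 d23 ?_
    intro i j hi hj
    simp only [xr, xs] at hi hj
    refine ⟨fun ⟨k1, k2⟩ => h.n2 ⟨⟨i, k1, ?_⟩, ⟨j, k2, ?_⟩⟩, fun ⟨k1, k2⟩ => h.n1 ⟨⟨i, ?_, k1⟩, ⟨j, ?_, k2⟩⟩⟩ <;> omega
  · intro ρ hρ
    simp only [mkD, ← mn_add] at hρ
    exact mn_nzd _ _ hρ
  · rw [mkD_A]; exact fb_ne ha0
  · rw [mkD_B]; exact fb_ne hb0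
  all_goals exact mn_ne _

/-! dimension -/

lemma ofList_eq : Ideal.ofList [mn K (xp a b), mn K (xq a b), mn K (xr a b), mn K (xs a b)] =
    Ideal.span (Set.range (gg K a b)) := by
  unfold Ideal.ofList
  congr 1
  ext x
  simp only [gg, Matrix.range_cons, Matrix.range_empty]
  simp only [List.mem_cons, List.not_mem_nil, or_false, Set.union_empty, Set.singleton_union, Set.mem_insert_iff, Set.mem_singleton_iff]
  rfl

lemma dim_le_of_wreg {R : Type} [CommRing R] [IsNoetherianRing R] (rs : List R) :
    ∀ (M : Type) [AddCommGroup M] [Module R M] [Module.Finite R M],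
    RingTheory.Sequence.IsWeaklyRegular M rs →
    Module.supportDim R (M ⧸ (Ideal.ofList rs • ⊤ : Submodule R M)) + rs.length ≤ Module.supportDim R M := by
  induction rs with
  | nil =>
    intro M _ _ _ _
    simp only [List.length_nil, Nat.cast_zero, add_zero]
    exact Module.supportDim_le_of_surjective _ (Submodule.mkQ_surjective _)
  | cons r rs ih =>
    intro M _ _ _ h
    rw [RingTheory.Sequence.isWeaklyRegular_cons_iff] at h
    rw [Module.supportDim_eq_of_equiv (Submodule.quotOfListConsSMulTopEquivQuotSMulTopInner M r rs)]
    have h1 := ih (QuotSMulTop r M) h.2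
    have h2 := Module.supportDim_quotSMulTop_succ_le_of_notMem_minimalPrimes
      (fun p hp => h.1.notMem_of_mem_minimalPrimes (p := p) hp)
    rw [List.length_cons, Nat.cast_add, Nat.cast_one, ← add_assoc]
    exact (add_le_add_left h1 1).trans h2

lemma quad_mem (hQ : Quad a b) : ∃ i : Fin 4 → σ, xp a b (i 0) ≠ 0 ∧ xq a b (i 1) ≠ 0 ∧ xr a b (i 2) ≠ 0 ∧ xs a b (i 3) ≠ 0 := by
  obtain ⟨⟨⟨i1, h1, h1'⟩, ⟨i2, h2, h2'⟩⟩, ⟨i3, h3, h3'⟩, ⟨i4, h4, h4'⟩⟩ := hQ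
  simp only [Pi.neg_apply] at h3' h4'
  refine ⟨![i3, i4, i1, i2], ?_, ?_, ?_, ?_⟩
  · change xp a b i3 ≠ 0; simp only [xp]; omega
  · change xq a b i4 ≠ 0; simp only [xq]; omega
  · change xr a b i1 ≠ 0; simp only [xr]; omega
  · change xs a b i2 ≠ 0; simp only [xs]; omega

lemma J_surj (hQ : Quad a b) : ∃ S : Finset σ, S.card ≤ 4 ∧
    ∃ f : (MvPolynomial σ K ⧸ Ideal.span (Set.range (gg K a b))) →+* MvPolynomial {k // k ∉ S} K,
      Function.Surjective f := by
  classical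
  obtain ⟨i, h0, h1, h2, h3⟩ := quad_mem hQ
  refine ⟨Finset.univ.image i, Finset.card_image_le.trans (by simp), ?_⟩
  let S := Finset.univ.image i
  let θ : MvPolynomial σ K →ₐ[K] MvPolynomial {k // k ∉ S} K :=
    aeval (fun k => if hk : k ∉ S then X ⟨k, hk⟩ else 0)
  have hθ : ∀ (e : σ → ℕ) (j : Fin 4), e (i j) ≠ 0 → θ (mn K e) = 0 := by
    intro e j hj
    rw [mn, map_prod]
    apply Finset.prod_eq_zero (Finset.mem_univ (i j))
    have : i j ∈ S := Finset.mem_image_of_mem _ (Finset.mem_univ j)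
    simp [θ, this, hj]
  have hle : ∀ x ∈ Ideal.span (Set.range (gg K a b)), (θ : MvPolynomial σ K →+* MvPolynomial {k // k ∉ S} K) x = 0 := by
    have : Ideal.span (Set.range (gg K a b)) ≤ RingHom.ker (θ : MvPolynomial σ K →+* MvPolynomial {k // k ∉ S} K) := by
      rw [Ideal.span_le]
      rintro _ ⟨j, rfl⟩
      change θ _ = 0
      fin_cases j
      · exact hθ _ 0 h0
      · exact hθ _ 1 h1
      · exact hθ _ 2 h2
      · exact hθ _ 3 h3
    exact fun x hx => this hx
  refine ⟨Ideal.Quotient.lift _ _ hle, ?_⟩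
  apply Ideal.Quotient.lift_surjective_of_surjective
  intro y
  have : θ.comp (rename (Subtype.val : {k // k ∉ S} → σ)) = AlgHom.id K _ := by
    apply MvPolynomial.algHom_ext
    intro k
    simp [θ, k.2]
  exact ⟨rename Subtype.val y, congrArg (fun f => f y) this⟩

lemma dim_J (d : ℕ) (hd : 2 ≤ d) (hc : Fintype.card σ = d + 2) (hQ : Quad a b) :
    ringKrullDim (MvPolynomial σ K ⧸ Ideal.span (Set.range (gg K a b))) = ((d - 2 : ℕ) : WithBot ℕ∞) := by
  classical
  apply le_antisymm
  · have h := dim_le_of_wreg _ (MvPolynomial σ K) (wreg_mn (K := K) _ (pw a b))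
    have e0 : List.map (mn K) [xp a b, xq a b, xr a b, xs a b] =
      [mn K (xp a b), mn K (xq a b), mn K (xr a b), mn K (xs a b)] := rfl
    rw [e0] at h
    rw [Module.supportDim_self_eq_ringKrullDim, MvPolynomial.ringKrullDim_of_isNoetherianRing,
      ringKrullDim_eq_zero_of_field, zero_add, Nat.card_eq_fintype_card, hc, ofList_eq,
      smul_eq_mul, Ideal.mul_top, Module.supportDim_quotient_eq_ringKrullDim] at h
    simp only [List.length_cons, List.length_nil, zero_add] at h
    generalize ringKrullDim (MvPolynomial σ K ⧸ Ideal.span (Set.range (gg K a b))) = x at h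
    induction x using WithBot.recBotCoe with
    | bot => exact bot_le
    | coe x =>
      induction x using ENat.recTopCoe with
      | top => 
        exfalso
        have h' : ((⊤ : ℕ∞) + ((4 : ℕ) : ℕ∞)) ≤ ((d + 2 : ℕ) : ℕ∞) := WithBot.coe_le_coe.mp h
        rw [top_add, top_le_iff] at h'
        exact ENat.natCast_ne_top _ h'
      | coe n =>
        have h1 : ((n : ℕ) : ℕ∞) + ((4 : ℕ) : ℕ∞) ≤ ((d + 2 : ℕ) : ℕ∞) := WithBot.coe_le_coe.mp h
        have h' : n + 4 ≤ d + 2 := by exact_mod_cast h1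
        have h2 : n ≤ d - 2 := by omega
        have h3 : (n : ℕ∞) ≤ ((d - 2 : ℕ) : ℕ∞) := by exact_mod_cast h2
        exact WithBot.coe_le_coe.mpr h3
  · obtain ⟨S, hS, f, hf⟩ := J_surj (K := K) hQ
    have h := ringKrullDim_le_of_surjective f hf
    rw [MvPolynomial.ringKrullDim_of_isNoetherianRing,
      ringKrullDim_eq_zero_of_field, zero_add, Nat.card_eq_fintype_card] at h
    refine le_trans ?_ h
    have h1 : Fintype.card {k // k ∉ S} = d + 2 - S.card := by
      rw [Fintype.card_subtype_compl, hc]; simp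
    rw [h1]
    have : d - 2 ≤ d + 2 - S.card := by omega
    exact_mod_cast this

lemma J_ne_top (hQ : Quad a b) : Ideal.span (Set.range (gg K a b)) ≠ ⊤ := by
  obtain ⟨S, hS, f, hf⟩ := J_surj (K := K) hQ
  intro h
  have : Subsingleton (MvPolynomial σ K ⧸ Ideal.span (Set.range (gg K a b))) :=
    Ideal.Quotient.subsingleton_iff.mpr h
  exact not_subsingleton _ hf.subsingleton

lemma reg (hQ : Quad a b) : RingTheory.Sequence.IsRegular (MvPolynomial σ K)
    [gg K a b 0, gg K a b 1, gg K a b 2, gg K a b 3] := by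
  refine ⟨wreg_mn (K := K) _ (pw a b), ?_⟩
  change (⊤ : Submodule _ _) ≠ Ideal.ofList [mn K (xp a b), mn K (xq a b), mn K (xr a b), mn K (xs a b)] • ⊤
  rw [ofList_eq, smul_eq_mul, Ideal.mul_top]
  exact (J_ne_top hQ).symm

lemma gg_mono (i : Fin 4) : ∃ u : σ →₀ ℕ, gg K a b i = monomial u 1 := by
  fin_cases i
  · exact ⟨_, mn_eq _⟩
  · exact ⟨_, mn_eq _⟩
  · exact ⟨_, mn_eq _⟩
  · exact ⟨_, mn_eq _⟩

instance : IsRegularRing (MvPolynomial σ K) := by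
  have : IsRegularRing K := inferInstance
  exact MvPolynomial.isRegularRing_of_isRegularRing K
end lat4
end Pf

/-- for a codimension-two lattice ring `A = R/I_L` of dimension `d` with
`I_L` minimally generated by `4` binomials, `D^{d-1}(A)` is a complete intersection
(cut out by 4 monomials forming a regular sequence); in particular `K_A` is
Cohen–Macaulay of dimension `d`, the `S₂`-fication of `A` is a Macaulayfication, and the
non-Cohen–Macaulay locus of `A` is the support of a Cohen–Macaulay module of
dimension `d-2`. -/
theorem stmt_13 (K : Type) [Field K] (d : ℕ) (hd : 2 ≤ d)
    (L : AddSubgroup (Fin (d + 2) → ℤ))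
    (hpos : ∀ u ∈ L, u ≠ 0 → (∃ i, 0 < u i) ∧ (∃ i, u i < 0))
    (hrk : Module.finrank ℤ ↥(AddSubgroup.toIntSubmodule L) = 2)
    (hdim : ringKrullDim
      (MvPolynomial (Fin (d + 2)) K ⧸ latticeIdeal K (L : Set (Fin (d + 2) → ℤ))) = d)
    (hgen4 : ∃ f : Fin 4 → MvPolynomial (Fin (d + 2)) K,
      latticeIdeal K (L : Set (Fin (d + 2) → ℤ)) = Ideal.span (Set.range f))
    (hmin : ¬ ∃ f : Fin 3 → MvPolynomial (Fin (d + 2)) K,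
      latticeIdeal K (L : Set (Fin (d + 2) → ℤ)) = Ideal.span (Set.range f)) :
    -- `D^{d-1}(A)` is a complete intersection cut out by four monomials
    (∃ g : Fin 4 → MvPolynomial (Fin (d + 2)) K,
      (∀ i, ∃ u : Fin (d + 2) →₀ ℕ, g i = monomial u 1) ∧
      RingTheory.Sequence.IsRegular (MvPolynomial (Fin (d + 2)) K) [g 0, g 1, g 2, g 3] ∧
      Nonempty
        (↥(extModule (MvPolynomial (Fin (d + 2)) K) ((d + 2) - (d - 1))
            (MvPolynomial (Fin (d + 2)) K ⧸ latticeIdeal K (L : Set (Fin (d + 2) → ℤ)))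
            (MvPolynomial (Fin (d + 2)) K)) ≃ₗ[MvPolynomial (Fin (d + 2)) K]
          (MvPolynomial (Fin (d + 2)) K ⧸ Ideal.span (Set.range g)))) ∧
    -- the canonical module is Cohen–Macaulay of dimension `d`
    (IsCMModAll (MvPolynomial (Fin (d + 2)) K)
      ↥(extModule (MvPolynomial (Fin (d + 2)) K) 2
          (MvPolynomial (Fin (d + 2)) K ⧸ latticeIdeal K (L : Set (Fin (d + 2) → ℤ)))
          (MvPolynomial (Fin (d + 2)) K)) ∧
     moduleDim (MvPolynomial (Fin (d + 2)) K)
      ↥(extModule (MvPolynomial (Fin (d + 2)) K) 2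
          (MvPolynomial (Fin (d + 2)) K ⧸ latticeIdeal K (L : Set (Fin (d + 2) → ℤ)))
          (MvPolynomial (Fin (d + 2)) K)) = (d : WithBot ℕ∞)) ∧
    -- the `S₂`-fication of `A` is a Macaulayfication
    (∃ (A' : ModuleCat (MvPolynomial (Fin (d + 2)) K))
        (ι : (MvPolynomial (Fin (d + 2)) K ⧸ latticeIdeal K (L : Set (Fin (d + 2) → ℤ)))
          →ₗ[MvPolynomial (Fin (d + 2)) K] ↥A'),
      Function.Injective ι ∧ SerreS2 (MvPolynomial (Fin (d + 2)) K) ↥A' ∧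
      moduleDim (MvPolynomial (Fin (d + 2)) K) (↥A' ⧸ LinearMap.range ι) ≤
        ((d - 2 : ℕ) : WithBot ℕ∞) ∧
      IsCMModAll (MvPolynomial (Fin (d + 2)) K) ↥A') ∧
    -- the non-CM locus of `A` is the support of a CM module of dimension `d - 2`
    (∃ N : ModuleCat (MvPolynomial (Fin (d + 2)) K),
      Module.Finite (MvPolynomial (Fin (d + 2)) K) ↥N ∧
      IsCMModAll (MvPolynomial (Fin (d + 2)) K) ↥N ∧
      moduleDim (MvPolynomial (Fin (d + 2)) K) ↥N = ((d - 2 : ℕ) : WithBot ℕ∞) ∧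
      ∀ (P : Ideal (MvPolynomial (Fin (d + 2)) K)) (hP : P.IsPrime),
        ((⟨P, hP⟩ : PrimeSpectrum (MvPolynomial (Fin (d + 2)) K)) ∈
            Module.support (MvPolynomial (Fin (d + 2)) K) ↥N ↔
          ¬ IsCM (Localization.AtPrime P) (LocalizedModule P.primeCompl
            (MvPolynomial (Fin (d + 2)) K ⧸
              latticeIdeal K (L : Set (Fin (d + 2) → ℤ)))))) := by
  obtain ⟨a0, b0, hB0⟩ := Pf.exists_bas hrk
  obtain ⟨a, b, hB, hQ⟩ := Pf.exists_quad (K := K) hB0 hmin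
  have hD := Pf.good (Pf.exists_sit hgen4 hB hQ)
  refine ⟨⟨Pf.gg K a b, Pf.gg_mono, Pf.reg hQ, ?_⟩, ?_⟩
  · have e : (d + 2) - (d - 1) = 3 := by omega
    rw [e]
    exact hD.ext3
  · exact Pf.Dat.assemble hD d hdim (Pf.dim_J d hd (by simp) hQ)
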